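/- arXiv:1907.11028 — 2 statements merged into one kernel-verified Lean document; each statement's English description precedes it below -/
import Mathlib

section
/- Assume there exist r, R, δ ∈ (0,∞) with r < R and an index i₀ ∈ {1,…,n} such that: (i) max over i=1,…,n and l=0,…,m_i of ( λ_i·f̄_{iR}·K_{il} + Σ_{j=1}^{p_i} η_{ij}·‖γ_{ij}^{(l)}‖_∞·H_{ijR} ) ≤ R; and (ii) λ_{i₀} ≥ μ_{i₀}/δ and f_{i₀}(t, x₁₀,…,x₁m₁,…,x_{n0},…,x_{n m_n}) ≥ δ·x_{i₀0} for all (t, x₁₀,…,x_{n m_n}) ∈ I_r. Then the system u_i(t) = λ_i ∫₀¹ k_i(t,s) f_i(s, u₁(s),…,u₁^{(m₁)}(s),…,u_n(s),…,u_n^{(m_n)}(s)) ds + Σ_{j=1}^{p_i} η_{ij} γ_{ij}(t) h_{ij}[u], t ∈ [0,1], i = 1,…,n, has a solution u ∈ P with r ≤ ‖u‖ ≤ R. -/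
open Set MeasureTheory

/-- The `Cᵐ[0,1]` norm `max_{0 ≤ j ≤ mi} ‖g⁽ʲ⁾‖_∞` (derivatives within `[0,1]`). -/
noncomputable def normCm (mi : ℕ) (g : ℝ → ℝ) : ℝ :=
  ⨆ j : Fin (mi + 1), ⨆ t : Set.Icc (0:ℝ) 1, |iteratedDerivWithin j.val g (Set.Icc 0 1) ↑t|

/-- The norm `‖u‖ = max_i ‖u_i‖_{C^{m_i}}` on `∏ᵢ C^{m_i}[0,1]`. -/
noncomputable def normP {n : ℕ} (m : Fin n → ℕ) (u : Fin n → ℝ → ℝ) : ℝ :=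
  ⨆ i, normCm (m i) (u i)

/-- Membership in the cone `P = {u ∈ ∏ᵢ C^{m_i}[0,1] : uᵢ ≥ 0 on [0,1]}`. -/
def memP {n : ℕ} (m : Fin n → ℕ) (u : Fin n → ℝ → ℝ) : Prop :=
  (∀ i, ContDiffOn ℝ (m i) (u i) (Set.Icc 0 1)) ∧
  (∀ i, ∀ t ∈ Set.Icc (0:ℝ) 1, 0 ≤ u i t)

/-- The vector `(u₁(s),…,u₁^{(m₁)}(s),…,u_n(s),…,u_n^{(m_n)}(s))` of values and
derivatives (within `[0,1]`), fed to the nonlinearities. -/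
noncomputable def jet {n : ℕ} (m : Fin n → ℕ) (u : Fin n → ℝ → ℝ) (s : ℝ) :
    (j : Fin n) → Fin (m j + 1) → ℝ :=
  fun j l => iteratedDerivWithin l.val (u j) (Set.Icc 0 1) s

/-- The box `∏ᵢ ([0,ρ] × [−ρ,ρ]^{m_i})`, i.e. the `x`-section of `I_ρ`. -/
def Jset {n : ℕ} (m : Fin n → ℕ) (ρ : ℝ) : Set ((j : Fin n) → Fin (m j + 1) → ℝ) :=
  {x | ∀ j, x j 0 ∈ Set.Icc (0:ℝ) ρ ∧ ∀ l : Fin (m j + 1), l ≠ 0 → x j l ∈ Set.Icc (-ρ) ρ}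

/-- The sup norm `‖g‖_∞` on `[0,1]`. -/
noncomputable def supIcc (g : ℝ → ℝ) : ℝ := ⨆ t : Set.Icc (0:ℝ) 1, |g ↑t|

open Metric in
/-- Extending a Lipschitz map on the closed unit ball vanishing on the sphere by zero. -/
lemma LipschitzOnWith.extend_zero_of_closedBall {E : Type*} [NormedAddCommGroup E]
    [NormedSpace ℝ E] {h : E → E} {K : NNReal} (hK : LipschitzOnWith K h (closedBall 0 1))
    (h0 : ∀ x, 1 ≤ ‖x‖ → h x = 0) : LipschitzWith K h := by
  have key : ∀ x y : E, ‖x‖ ≤ 1 → 1 ≤ ‖y‖ → dist (h x) (h y) ≤ K * dist x y := by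
    intro x y hx hy
    have hc : ContinuousOn (fun s : ℝ => ‖x + s • (y - x)‖) (Icc 0 1) := by fun_prop
    have h1 : (1 : ℝ) ∈ Icc ‖x + (0 : ℝ) • (y - x)‖ ‖x + (1 : ℝ) • (y - x)‖ := by
      simp [hx, hy]
    obtain ⟨s, hs, hs1⟩ := intermediate_value_Icc zero_le_one hc h1
    simp only at hs1
    have e1 : h y = h (x + s • (y - x)) := by rw [h0 y hy, h0 _ hs1.ge]
    rw [e1]
    refine (hK.dist_le_mul x (by simpa using hx) _ (by simp [hs1])).trans ?_
    gcongr
    rw [dist_eq_norm, dist_eq_norm]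
    have : x - (x + s • (y - x)) = s • (x - y) := by module
    rw [this, norm_smul, Real.norm_of_nonneg hs.1]
    exact mul_le_of_le_one_left (norm_nonneg _) hs.2
  refine LipschitzWith.of_dist_le_mul fun x y => ?_
  rcases le_total ‖x‖ 1 with hx | hx <;> rcases le_total ‖y‖ 1 with hy | hy
  · exact hK.dist_le_mul x (by simpa using hx) y (by simpa using hy)
  · exact key x y hx hy
  · rw [dist_comm, dist_comm x]; exact key y x hy hx
  · rw [h0 x hx, h0 y hy, dist_self]; positivity

/-- A perturbation of the identity by a contraction is bijective. -/
lemma LipschitzWith.bijective_id_add_smul {E : Type*} [NormedAddCommGroup E]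
    [NormedSpace ℝ E] [CompleteSpace E] {h : E → E} {K : NNReal} (hK : LipschitzWith K h)
    {t : ℝ} (ht : 0 ≤ t) (htK : t * K < 1) : Function.Bijective fun x => x + t • h x := by
  have hl : ∀ x y, dist (t • h x) (t • h y) ≤ t * K * dist x y := fun x y => by
    rw [dist_smul₀, Real.norm_of_nonneg ht, mul_assoc]
    gcongr
    exact hK.dist_le_mul x y
  constructor
  · intro x y hxy
    by_contra hne
    have h1 : dist x y = dist (t • h x) (t • h y) := by
      simp only at hxy
      rw [dist_eq_norm, dist_eq_norm']
      congr 1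
      rw [← sub_eq_zero] at hxy ⊢
      rw [← hxy]
      abel
    have h2 := hl x y
    have h3 : 0 < dist x y := dist_pos.2 hne
    nlinarith
  · intro y
    have hc : ContractingWith ⟨t * K, by positivity⟩ (fun x => y - t • h x) := by
      refine ⟨by exact_mod_cast htK, LipschitzWith.of_dist_le_mul fun a b => ?_⟩
      rw [dist_sub_left]
      exact hl a b
    refine ⟨hc.fixedPoint _, ?_⟩
    have := hc.fixedPoint_isFixedPt
    simp only [Function.IsFixedPt] at this
    simp only
    nth_rewrite 1 [← this]
    abel

/-- The determinant of `1 + t • A` at `t = 1` is a universal affine combination of its values at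
prescribed nodes. -/
lemma exists_sum_mul_det_one_add_smul (E : Type*) [NormedAddCommGroup E] [NormedSpace ℝ E]
    [FiniteDimensional ℝ E] {ε : ℝ} (hε : 0 < ε) :
    ∃ (s : Finset ℕ) (v c : ℕ → ℝ), (∀ i ∈ s, 0 < v i ∧ v i < ε) ∧ ∑ i ∈ s, c i = 1 ∧
      ∀ A : E →L[ℝ] E, (1 + A).det = ∑ i ∈ s, c i * (1 + v i • A).det := by
  classical
  set d := Module.finrank ℝ E
  set v : ℕ → ℝ := fun i => ε / (i + 2) with hv
  have hinj : Function.Injective v := by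
    intro i j hij
    simp only [hv] at hij
    field_simp at hij
    have := hij
    have h2 : (i : ℝ) = j := by linarith
    exact_mod_cast h2
  set s := Finset.range (d + 1) with hs
  have hne : s.Nonempty := ⟨0, by simp [hs]⟩
  refine ⟨s, v, fun i => (Lagrange.basis s v i).eval 1, ?_, ?_, ?_⟩
  · intro i _
    refine ⟨by positivity, div_lt_self hε ?_⟩
    have : (0 : ℝ) ≤ i := by positivity
    linarith
  · rw [← Polynomial.eval_finsetSum, Lagrange.sum_basis hinj.injOn hne, Polynomial.eval_one]
  · intro A
    let b := Module.finBasis ℝ E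
    set M := LinearMap.toMatrix b b (A : E →ₗ[ℝ] E) with hM
    set q : Polynomial ℝ := Matrix.det ((Polynomial.X : Polynomial ℝ) • M.map Polynomial.C +
      (1 : Matrix _ _ ℝ).map Polynomial.C) with hq
    have hqe : ∀ t : ℝ, q.eval t = (1 + t • A).det := by
      intro t
      have h1 : (1 + t • A).det = (1 + t • M).det := by
        rw [ContinuousLinearMap.det, ← LinearMap.det_toMatrix b, hM]
        congr 1
        simp [LinearMap.toMatrix_one]
      rw [h1, hq, ← Polynomial.coe_evalRingHom, RingHom.map_det]
      congr 1
      ext i j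
      by_cases hij : i = j
      · subst hij; simp; ring
      · simp [hij]
        ring
    have hdeg : q.degree < s.card := by
      refine (Polynomial.degree_le_natDegree).trans_lt ?_
      have := Polynomial.natDegree_det_X_add_C_le M 1
      rw [Fintype.card_fin] at this
      rw [hs, Finset.card_range]
      exact_mod_cast Nat.lt_succ_of_le this
    have h2 := congrArg (Polynomial.eval 1) (Lagrange.eq_interpolate (s := s) hinj.injOn hdeg)
    rw [hqe 1, one_smul, Lagrange.interpolate_apply, Polynomial.eval_finsetSum] at h2
    rw [h2]
    refine Finset.sum_congr rfl fun i _ => ?_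
    rw [Polynomial.eval_mul, Polynomial.eval_C, hqe, mul_comm]

open Metric in
/-- There is no continuously differentiable retraction of the closed unit ball onto its sphere. -/
theorem no_contDiff_retraction_sphere {E : Type*} [NormedAddCommGroup E] [InnerProductSpace ℝ E]
    [FiniteDimensional ℝ E] {U : Set E} (hU : IsOpen U) (hBU : closedBall (0 : E) 1 ⊆ U)
    {g : E → E} (hg : ContDiffOn ℝ 1 g U) (hg1 : ∀ x, ‖x‖ ≤ 1 → ‖g x‖ = 1)
    (hgid : ∀ x, ‖x‖ = 1 → g x = x) : False := by
  classical
  let _ : MeasurableSpace E := borel E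
  have : BorelSpace E := ⟨rfl⟩
  let μ : Measure E := Measure.addHaar
  set h : E → E := fun x => if ‖x‖ ≤ 1 then g x - x else 0 with hh
  have hh0 : ∀ x, 1 ≤ ‖x‖ → h x = 0 := by
    intro x hx
    rcases hx.eq_or_lt with hx | hx
    · simp [hh, hgid x hx.symm]
    · simp [hh, not_le.2 hx]
  have hhb : ∀ x, ‖x‖ ≤ 1 → h x = g x - x := fun x hx => by simp [hh, hx]
  obtain ⟨K, hK⟩ : ∃ K, LipschitzOnWith K (fun x => g x - x) (closedBall (0 : E) 1) := by
    have : ContDiffOn ℝ 1 (fun x => g x - x) (closedBall (0 : E) 1) :=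
      (hg.mono hBU).sub contDiffOn_id
    exact (this.locallyLipschitzOn (convex_closedBall _ _)).exists_lipschitzOnWith_of_compact
      (isCompact_closedBall _ _)
  have hKh : LipschitzWith K h := by
    refine LipschitzOnWith.extend_zero_of_closedBall (fun x hx y hy => ?_) hh0
    rw [hhb x (by simpa using hx), hhb y (by simpa using hy)]
    exact hK hx hy
  set A : E → E →L[ℝ] E := fun x => fderiv ℝ g x - 1 with hA
  have hAc : ContinuousOn A (closedBall 0 1) :=
    ((hg.continuousOn_fderiv_of_isOpen hU le_rfl).mono hBU).sub continuousOn_const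
  have hgd : ∀ x ∈ closedBall (0 : E) 1, HasFDerivAt g (fderiv ℝ g x) x := fun x hx =>
    ((hg.differentiableOn one_ne_zero).differentiableAt (hU.mem_nhds (hBU hx))).hasFDerivAt
  -- positivity of the Jacobian for small times
  obtain ⟨ε₁, hε₁, hdet⟩ : ∃ ε₁ > 0, ∀ M : E →L[ℝ] E, ‖M‖ < ε₁ → 0 < (1 + M).det := by
    have hc : ContinuousAt (fun M : E →L[ℝ] E => (1 + M).det) 0 :=
      (ContinuousLinearMap.continuous_det.comp (continuous_const.add continuous_id)).continuousAt
    have h1 : (0 : ℝ) < (1 + (0 : E →L[ℝ] E)).det := by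
      simp [ContinuousLinearMap.det]
    obtain ⟨e, he, H⟩ := Metric.eventually_nhds_iff.1 (hc.eventually (lt_mem_nhds h1))
    exact ⟨e, he, fun M hM => H (by simpa using hM)⟩
  obtain ⟨C, hC⟩ : ∃ C, ∀ x ∈ closedBall (0 : E) 1, ‖A x‖ ≤ C :=
    (isCompact_closedBall _ _).exists_bound_of_continuousOn hAc
  have hC0 : 0 ≤ C := (norm_nonneg _).trans (hC 0 (by simp))
  set ε : ℝ := min 1 (min (1 / (K + 1)) (ε₁ / (C + 1))) with hε
  have hεpos : 0 < ε := by positivity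
  have hvol : ∀ t : ℝ, 0 < t → t < ε →
      ∫ x in ball (0 : E) 1, (1 + t • A x).det ∂μ = μ.real (ball (0 : E) 1) := by
    intro t ht0 htε
    have ht1 : t < 1 := htε.trans_le (min_le_left _ _)
    have htK : t * K < 1 := by
      have : t < 1 / (K + 1) := htε.trans_le ((min_le_right _ _).trans (min_le_left _ _))
      rw [lt_div_iff₀ (by positivity)] at this
      linarith
    have htC : t * C < ε₁ := by
      have : t < ε₁ / (C + 1) := htε.trans_le ((min_le_right _ _).trans (min_le_right _ _))
      rw [lt_div_iff₀ (by positivity)] at this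
      linarith
    have hbij := hKh.bijective_id_add_smul ht0.le htK
    have himg : (fun x => x + t • h x) '' ball 0 1 = ball 0 1 := by
      ext y
      constructor
      · rintro ⟨x, hx, rfl⟩
        have hx1 : ‖x‖ < 1 := by simpa using hx
        have e : x + t • h x = (1 - t) • x + t • g x := by rw [hhb x hx1.le]; module
        simp only [mem_ball_zero_iff]
        rw [e]
        refine (norm_add_le _ _).trans_lt ?_
        rw [norm_smul, norm_smul, hg1 x hx1.le, Real.norm_of_nonneg ht0.le,
          Real.norm_of_nonneg (by linarith)]
        nlinarith
      · intro hy
        obtain ⟨x, rfl⟩ := hbij.2 y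
        refine ⟨x, ?_, rfl⟩
        by_contra hx
        have hx1 : 1 ≤ ‖x‖ := by simpa using hx
        simp only [mem_ball_zero_iff, hh0 x hx1, smul_zero, add_zero] at hy
        linarith
    have hder : ∀ x ∈ ball (0 : E) 1,
        HasFDerivWithinAt (fun x => x + t • h x) (1 + t • A x) (ball 0 1) x := by
      intro x hx
      have h1 : HasFDerivWithinAt (fun x => x + t • (g x - x)) (1 + t • A x) (ball 0 1) x := by
        have := hgd x (ball_subset_closedBall hx)
        exact ((hasFDerivAt_id x).add ((this.sub (hasFDerivAt_id x)).const_smul t)).hasFDerivWithinAt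
      refine h1.congr (fun y hy => ?_) ?_
      · rw [hhb y (by simpa using (mem_ball_zero_iff.1 hy).le)]
      · rw [hhb x (by simpa using (mem_ball_zero_iff.1 hx).le)]
    have := integral_image_eq_integral_abs_det_fderiv_smul μ measurableSet_ball hder
      hbij.1.injOn (fun _ => (1 : ℝ))
    rw [himg] at this
    simp only [integral_const, smul_eq_mul, mul_one, measureReal_restrict_apply_univ] at this
    rw [this]
    refine setIntegral_congr_fun measurableSet_ball fun x hx => ?_
    have hpos : 0 < (1 + t • A x).det := by
      refine hdet _ ?_
      rw [norm_smul, Real.norm_of_nonneg ht0.le]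
      exact (mul_le_mul_of_nonneg_left (hC x (ball_subset_closedBall hx)) ht0.le).trans_lt htC
    simp [abs_of_pos hpos]
  have hint : ∀ t : ℝ, IntegrableOn (fun x => (1 + t • A x).det) (ball (0 : E) 1) μ := by
    intro t
    refine IntegrableOn.mono_set ?_ ball_subset_closedBall
    refine ContinuousOn.integrableOn_compact (isCompact_closedBall _ _) ?_
    exact ContinuousLinearMap.continuous_det.comp_continuousOn
      (continuousOn_const.add (hAc.const_smul t))
  obtain ⟨s, v, c, hv, hc, hsum⟩ := exists_sum_mul_det_one_add_smul E hεpos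
  have h1 : ∫ x in ball (0 : E) 1, (1 + A x).det ∂μ = μ.real (ball (0 : E) 1) := by
    rw [setIntegral_congr_fun measurableSet_ball fun x _ => hsum (A x)]
    rw [integral_finsetSum _ fun i _ => (hint (v i)).const_mul (c i)]
    simp_rw [integral_const_mul]
    rw [Finset.sum_congr rfl fun i hi => by rw [hvol (v i) (hv i hi).1 (hv i hi).2],
      ← Finset.sum_mul, hc, one_mul]
  have h2 : ∫ x in ball (0 : E) 1, (1 + A x).det ∂μ = 0 := by
    rw [setIntegral_congr_fun (g := fun _ => (0 : ℝ)) measurableSet_ball, integral_zero]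
    intro x hx
    simp only [hA, add_sub_cancel]
    by_contra hne
    have hx1 : ‖x‖ < 1 := by simpa using hx
    have hd := hgd x (ball_subset_closedBall hx)
    have horth : ∀ w, inner ℝ (g x) (fderiv ℝ g x w) = 0 := by
      intro w
      have e1 : HasFDerivAt (fun y => ‖g y‖ ^ 2) (0 : E →L[ℝ] ℝ) x := by
        refine (hasFDerivAt_const (1 : ℝ) x).congr_of_eventuallyEq ?_
        filter_upwards [isOpen_ball.mem_nhds hx] with y hy
        rw [hg1 y (mem_ball_zero_iff.1 hy).le]; norm_num
      have e2 := hd.norm_sq.unique e1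
      have := congrArg (fun T : E →L[ℝ] ℝ => T w) e2
      simpa using this
    have hsurj : Function.Surjective (fderiv ℝ g x) :=
      (LinearMap.equivOfDetNeZero (fderiv ℝ g x : E →ₗ[ℝ] E) hne).surjective
    obtain ⟨w, hw⟩ := hsurj (g x)
    have := horth w
    rw [hw, real_inner_self_eq_norm_sq, hg1 x hx1.le] at this
    norm_num at this
  have h3 : 0 < μ.real (ball (0 : E) 1) :=
    ENNReal.toReal_pos (measure_ball_pos μ 0 one_pos).ne' measure_ball_lt_top.ne
  linarith

/-- Brouwer's fixed point theorem for continuously differentiable maps into the open ball. -/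
lemma exists_fixedPoint_of_contDiff_of_norm_lt_one {E : Type*} [NormedAddCommGroup E]
    [InnerProductSpace ℝ E] [FiniteDimensional ℝ E] {p : E → E} (hp : ContDiff ℝ 1 p)
    (hp1 : ∀ x, ‖x‖ ≤ 1 → ‖p x‖ < 1) : ∃ x, ‖x‖ ≤ 1 ∧ p x = x := by
  by_contra! hfix
  set v : E → E := fun x => x - p x with hv
  have hvc : ContDiff ℝ 1 v := contDiff_id.sub hp
  set D : E → ℝ := fun x => inner ℝ x (v x) ^ 2 + ‖v x‖ ^ 2 * (1 - ‖x‖ ^ 2) with hD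
  have hDc : ContDiff ℝ 1 D :=
    ((contDiff_id.inner ℝ hvc).pow 2).add ((hvc.norm_sq ℝ).mul
      (contDiff_const.sub (contDiff_id.norm_sq ℝ)))
  set U : Set E := {x | v x ≠ 0} ∩ {x | 0 < D x} with hU
  have hUo : IsOpen U :=
    (isOpen_ne_fun hvc.continuous continuous_const).inter
      (isOpen_lt continuous_const hDc.continuous)
  set g : E → E := fun x => x + ((-inner ℝ x (v x) + √(D x)) / ‖v x‖ ^ 2) • v x with hg
  have hv0 : ∀ x, ‖x‖ ≤ 1 → v x ≠ 0 := fun x hx h => hfix x hx (sub_eq_zero.1 h).symm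
  have hpos : ∀ x, ‖x‖ = 1 → 0 < inner ℝ x (v x) := by
    intro x hx
    have h1 : inner ℝ x (p x) ≤ ‖x‖ * ‖p x‖ := real_inner_le_norm _ _
    have h2 := hp1 x hx.le
    rw [hv]
    simp only [inner_sub_right, real_inner_self_eq_norm_sq]
    rw [hx] at h1 ⊢
    linarith
  have hDpos : ∀ x, ‖x‖ ≤ 1 → 0 < D x := by
    intro x hx
    have hvx : 0 < ‖v x‖ ^ 2 := by have := norm_pos_iff.2 (hv0 x hx); positivity
    rcases hx.eq_or_lt with h | h
    · have := hpos x h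
      simp only [hD, h]
      nlinarith
    · have : 0 < 1 - ‖x‖ ^ 2 := by nlinarith [norm_nonneg x]
      simp only [hD]
      positivity
  refine no_contDiff_retraction_sphere hUo (fun x hx => ?_) (g := g) ?_ ?_ ?_
  · have hx' : ‖x‖ ≤ 1 := by simpa using hx
    exact ⟨hv0 x hx', hDpos x hx'⟩
  · refine contDiffOn_id.add (ContDiffOn.smul (ContDiffOn.div ?_ ?_ ?_) hvc.contDiffOn)
    · exact (contDiff_id.inner ℝ hvc).neg.contDiffOn.add
        (hDc.contDiffOn.sqrt fun x hx => hx.2.ne')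
    · exact (hvc.norm_sq ℝ).contDiffOn
    · intro x hx
      have := norm_pos_iff.2 hx.1
      positivity
  · intro x hx
    have hvx : ‖v x‖ ≠ 0 := (norm_pos_iff.2 (hv0 x hx)).ne'
    have hs := Real.sq_sqrt (hDpos x hx).le
    have : ‖g x‖ ^ 2 = 1 := by
      simp only [hg]
      rw [norm_add_sq_real, inner_smul_right, norm_smul, mul_pow, Real.norm_eq_abs, sq_abs]
      field_simp
      nth_rewrite 2 [hD] at hs
      simp only at hs
      linear_combination hs
    have h0 := norm_nonneg (g x)
    nlinarith
  · intro x hx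
    have h1 : D x = inner ℝ x (v x) ^ 2 := by simp [hD, hx]
    simp only [hg, h1, Real.sqrt_sq (hpos x hx).le]
    simp

/-- Brouwer's fixed point theorem. -/
theorem Continuous.exists_fixedPoint_of_norm_le_one {E : Type*} [NormedAddCommGroup E]
    [InnerProductSpace ℝ E] [FiniteDimensional ℝ E] {f : E → E} (hf : Continuous f)
    (hf1 : ∀ x, ‖f x‖ ≤ 1) : ∃ x, f x = x := by
  by_contra! hfix
  obtain ⟨ε, hε, hεf⟩ : ∃ ε > 0, ∀ x ∈ Metric.closedBall (0 : E) 1, ε ≤ ‖f x - x‖ := by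
    obtain ⟨x₀, -, hx₀⟩ := (isCompact_closedBall (0 : E) 1).exists_isMinOn ⟨0, by simp⟩
      (hf.sub continuous_id).norm.continuousOn
    exact ⟨‖f x₀ - x₀‖, norm_pos_iff.2 (sub_ne_zero.2 (hfix x₀)), fun x hx => hx₀ hx⟩
  set F : E → E := fun x => (max 0 (min 1 (2 - ‖x‖))) • f x with hF
  have hFc : Continuous F := by fun_prop
  have hFs : HasCompactSupport F := by
    refine HasCompactSupport.intro (isCompact_closedBall (0 : E) 2) fun x hx => ?_
    have hx' : 2 < ‖x‖ := by simpa using hx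
    have : max 0 (min 1 (2 - ‖x‖)) = 0 :=
      max_eq_left ((min_le_right _ _).trans (by linarith))
    simp [hF, this]
  have hFf : ∀ x, ‖x‖ ≤ 1 → F x = f x := by
    intro x hx
    have : max 0 (min 1 (2 - ‖x‖)) = 1 := by
      rw [min_eq_left (by linarith), max_eq_right zero_le_one]
    simp [hF, this]
  obtain ⟨q, hq, hqF⟩ :=
    (hFs.uniformContinuous_of_continuous hFc).exists_contDiff_dist_le (half_pos hε)
  have hc : (0 : ℝ) < 1 + ε / 2 := by positivity
  have hqn : ∀ x, ‖x‖ ≤ 1 → ‖q x - f x‖ < ε / 2 ∧ ‖q x‖ < 1 + ε / 2 := by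
    intro x hx
    have h1 : ‖q x - f x‖ < ε / 2 := by rw [← hFf x hx, ← dist_eq_norm]; exact hqF x
    have h2 : ‖q x‖ ≤ ‖f x‖ + ‖q x - f x‖ := norm_le_insert' _ _
    exact ⟨h1, by linarith [hf1 x]⟩
  obtain ⟨x, hx, hxe⟩ := exists_fixedPoint_of_contDiff_of_norm_lt_one
    (p := fun x => (1 + ε / 2)⁻¹ • q x) ((hq.of_le (by simp)).const_smul _) (fun x hx => by
      rw [norm_smul, Real.norm_of_nonneg (by positivity), inv_mul_lt_iff₀ hc, mul_one]
      exact (hqn x hx).2)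
  have h1 := hεf x (by simpa using hx)
  have hqx : q x = (1 + ε / 2) • x := by
    rw [← hxe, smul_smul, mul_inv_cancel₀ hc.ne', one_smul, hxe]
  have h2 : f x - x = (ε / 2) • x - (q x - f x) := by rw [hqx]; module
  rw [h2] at h1
  have h3 := norm_sub_le ((ε / 2) • x) (q x - f x)
  rw [norm_smul, Real.norm_of_nonneg (by positivity)] at h3
  have h4 := (hqn x hx).1
  nlinarith

/-- Brouwer's fixed point theorem on the standard simplex. -/
theorem ContinuousOn.exists_fixedPoint_stdSimplex {ι : Type*} [Fintype ι] [Nonempty ι]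
    {f : (ι → ℝ) → ι → ℝ} (hf : ContinuousOn f (stdSimplex ℝ ι))
    (hmaps : MapsTo f (stdSimplex ℝ ι) (stdSimplex ℝ ι)) :
    ∃ x ∈ stdSimplex ℝ ι, f x = x := by
  classical
  set N : ℝ := (Fintype.card ι : ℝ) with hN
  have hNpos : 0 < N := by simp [hN, Fintype.card_pos]
  set S : (ι → ℝ) → ℝ := fun x => ∑ i, max (x i) 0 with hS
  set ρ : (ι → ℝ) → ι → ℝ := fun x i => (max (x i) 0 + max (1 - S x) 0 / N) / max 1 (S x) with hρ
  have hρc : Continuous ρ := by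
    have hSc : Continuous S := by fun_prop
    refine continuous_pi fun i => Continuous.div (by fun_prop) (by fun_prop) fun x => ?_
    exact (lt_max_of_lt_left one_pos).ne'
  have hρm : ∀ x, ρ x ∈ stdSimplex ℝ ι := by
    intro x
    refine ⟨fun i => by positivity, ?_⟩
    simp only [hρ]
    rw [← Finset.sum_div, Finset.sum_add_distrib, Finset.sum_const, Finset.card_univ, nsmul_eq_mul,
      mul_div_cancel₀ _ hNpos.ne']
    change (S x + _) / _ = 1
    rcases le_total (S x) 1 with h | h
    · rw [max_eq_left (by linarith), max_eq_left h]; ring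
    · rw [max_eq_right (by linarith), max_eq_right h, add_zero, div_self (by linarith)]
  have hρid : ∀ x ∈ stdSimplex ℝ ι, ρ x = x := by
    intro x hx
    have h1 : S x = 1 := by
      rw [← hx.2]
      exact Finset.sum_congr rfl fun i _ => max_eq_left (hx.1 i)
    funext i
    simp [hρ, h1, max_eq_left (hx.1 i)]
  have hle : ∀ x ∈ stdSimplex ℝ ι, ‖WithLp.toLp 2 x‖ ≤ 1 := by
    intro x hx
    rw [EuclideanSpace.norm_eq]
    refine Real.sqrt_le_one.2 ?_
    rw [← hx.2]
    refine Finset.sum_le_sum fun i _ => ?_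
    have h0 := hx.1 i
    have h1 : x i ≤ 1 := hx.2 ▸ Finset.single_le_sum (fun j _ => hx.1 j) (Finset.mem_univ i)
    simp only [Real.norm_eq_abs, sq_abs]
    nlinarith
  have hfρ : Continuous fun x => f (ρ x) := by
    exact hf.comp_continuous hρc hρm
  obtain ⟨y, hy⟩ := Continuous.exists_fixedPoint_of_norm_le_one
    (f := fun y : EuclideanSpace ℝ ι => WithLp.toLp 2 (f (ρ (WithLp.ofLp y))))
    ((PiLp.continuous_toLp 2 _).comp (hfρ.comp (PiLp.continuous_ofLp 2 _)))
    (fun y => hle _ (hmaps (hρm _)))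
  have hy' : f (ρ (WithLp.ofLp y)) = WithLp.ofLp y := by
    conv_rhs => rw [← hy]
  have hmem : WithLp.ofLp y ∈ stdSimplex ℝ ι := hy' ▸ hmaps (hρm _)
  exact ⟨WithLp.ofLp y, hmem, by rwa [hρid _ hmem] at hy'⟩

/-- Schauder's fixed point theorem: a continuous self-map of a closed convex set whose image is
contained in a compact set has a fixed point. -/
theorem Convex.exists_fixedPoint_of_isCompact {E : Type*} [NormedAddCommGroup E]
    [NormedSpace ℝ E] {K Q : Set E} (hKc : Convex ℝ K) (hKcl : IsClosed K) (hKne : K.Nonempty)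
    {S : E → E} (hS : ContinuousOn S K) (hmaps : MapsTo S K K) (hQ : IsCompact Q)
    (hSQ : MapsTo S K Q) : ∃ x ∈ K, S x = x := by
  classical
  have happrox : ∀ ε > 0, ∃ x ∈ K, dist (S x) x < ε := by
    intro ε hε
    obtain ⟨T, hTS, hTfin, hTcov⟩ : ∃ T ⊆ S '' K, T.Finite ∧ S '' K ⊆ ⋃ y ∈ T, Metric.ball y ε :=
      Metric.finite_approx_of_totallyBounded
        (hQ.totallyBounded.subset (image_subset_iff.2 hSQ)) ε hε
    have : Fintype T := hTfin.fintype
    have : Nonempty T := by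
      obtain ⟨x, hx⟩ := hKne
      obtain ⟨y, hy, -⟩ := mem_iUnion₂.1 (hTcov (mem_image_of_mem S hx))
      exact ⟨⟨y, hy⟩⟩
    set a : T → E → ℝ := fun y x => max 0 (ε - dist x y) with ha
    have ha0 : ∀ y x, 0 ≤ a y x := fun y x => le_max_left _ _
    have hac : ∀ y, Continuous (a y) := fun y => by simp only [ha]; fun_prop
    have hasum : ∀ x ∈ S '' K, 0 < ∑ y, a y x := by
      intro x hx
      obtain ⟨y, hy, hxy⟩ := mem_iUnion₂.1 (hTcov hx)
      refine Finset.sum_pos' (fun y _ => ha0 y x) ⟨⟨y, hy⟩, Finset.mem_univ _, ?_⟩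
      exact lt_max_of_lt_right (sub_pos.2 hxy)
    set comb : (T → ℝ) → E := fun w => ∑ y, w y • (y : E) with hcomb
    have hcombc : Continuous comb := by simp only [hcomb]; fun_prop
    have hcombK : MapsTo comb (stdSimplex ℝ T) K := fun w hw =>
      hKc.sum_mem (fun y _ => hw.1 y) hw.2
        fun y _ => by obtain ⟨x, hx, he⟩ := hTS y.2; rw [← he]; exact hmaps hx
    set F : (T → ℝ) → T → ℝ := fun w y => a y (S (comb w)) / ∑ z, a z (S (comb w)) with hF
    have hSc : ContinuousOn (fun w => S (comb w)) (stdSimplex ℝ T) :=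
      hS.comp hcombc.continuousOn hcombK
    have hFc : ContinuousOn F (stdSimplex ℝ T) := by
      refine continuousOn_pi.2 fun y => ContinuousOn.div ((hac y).comp_continuousOn hSc)
        (continuousOn_finsetSum _ fun z _ => (hac z).comp_continuousOn hSc) fun w hw => ?_
      exact (hasum _ (mem_image_of_mem S (hcombK hw))).ne'
    have hFm : MapsTo F (stdSimplex ℝ T) (stdSimplex ℝ T) := by
      intro w hw
      have hp := hasum _ (mem_image_of_mem S (hcombK hw))
      refine ⟨fun y => div_nonneg (ha0 _ _) hp.le, ?_⟩
      simp only [hF]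
      rw [← Finset.sum_div, div_self hp.ne']
    obtain ⟨w, hw, hwF⟩ := hFc.exists_fixedPoint_stdSimplex hFm
    refine ⟨comb w, hcombK hw, ?_⟩
    have hmem : comb w ∈ Metric.ball (S (comb w)) ε := by
      have hb : Convex ℝ (Metric.ball (S (comb w)) ε) := convex_ball _ _
      suffices ∑ y, w y • (y : E) ∈ Metric.ball (S (comb w)) ε from this
      rw [← Finset.sum_filter_of_ne (p := fun y : T => w y ≠ 0)
        fun y _ h h0 => h (by rw [h0, zero_smul])]
      refine hb.sum_mem (fun y _ => hw.1 y) ?_ fun y hy => ?_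
      · rw [Finset.sum_filter_ne_zero, hw.2]
      · have hy0 : w y ≠ 0 := (Finset.mem_filter.1 hy).2
        rw [Metric.mem_ball']
        by_contra hd
        apply hy0
        rw [← hwF]
        simp only [hF]
        rw [show a y (S (comb w)) = 0 from max_eq_left (by push Not at hd; linarith), zero_div]
    rw [Metric.mem_ball'] at hmem
    exact hmem
  choose x hxK hx using fun k : ℕ => happrox (1 / ((k : ℝ) + 1)) Nat.one_div_pos_of_nat
  obtain ⟨y, -, φ, hφ, hlim⟩ := hQ.tendsto_subseq fun k => hSQ (hxK k)
  have hd : Filter.Tendsto (fun k => dist (S (x (φ k))) (x (φ k))) Filter.atTop (nhds 0) :=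
    squeeze_zero (fun _ => dist_nonneg) (fun k => (hx (φ k)).le)
      (tendsto_one_div_add_atTop_nhds_zero_nat.comp hφ.tendsto_atTop)
  have hxlim : Filter.Tendsto (fun k => x (φ k)) Filter.atTop (nhds y) :=
    (tendsto_iff_of_dist hd).1 hlim
  have hyK : y ∈ K := hKcl.mem_of_tendsto hxlim (Filter.Eventually.of_forall fun k => hxK _)
  refine ⟨y, hyK, tendsto_nhds_unique ?_ hlim⟩
  exact (hS y hyK).tendsto.comp (tendsto_nhdsWithin_iff.2
    ⟨hxlim, Filter.Eventually.of_forall fun k => hxK _⟩)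

/-- A compact map of a closed convex cone that does not increase the norm on the sphere of radius
`R`, and for which `x = T x + σ • φ` has no solution of norm less than `r` with `σ > 0`, has a fixed
point in the annulus between `r` and `R`. -/
theorem exists_fixedPoint_mem_annulus {E : Type*} [NormedAddCommGroup E] [NormedSpace ℝ E]
    {J Q : Set E} (hJc : Convex ℝ J) (hJcl : IsClosed J) (hJ0 : (0 : E) ∈ J)
    (hJadd : ∀ x ∈ J, ∀ y ∈ J, x + y ∈ J) (hJsmul : ∀ c : ℝ, 0 ≤ c → ∀ x ∈ J, c • x ∈ J)
    {r R : ℝ} (hR : 0 < R) (hrR : r < R) {T : E → E} (hT : ContinuousOn T J)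
    (hTJ : MapsTo T J J) (hQ : IsCompact Q) (hTQ : ∀ x ∈ J, ‖x‖ ≤ R → T x ∈ Q)
    (hTR : ∀ x ∈ J, ‖x‖ = R → ‖T x‖ ≤ R) {φ : E} (hφ : φ ∈ J)
    (hTr : ∀ x ∈ J, ‖x‖ < r → ∀ σ : ℝ, 0 < σ → x ≠ T x + σ • φ) :
    ∃ x ∈ J, T x = x ∧ r ≤ ‖x‖ ∧ ‖x‖ ≤ R := by
  set P : E → E := fun z => (R / max R ‖z‖) • z with hP
  have hmax : ∀ z : E, 0 < max R ‖z‖ := fun z => lt_max_of_lt_left hR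
  have hPc : Continuous P := by
    refine Continuous.smul (Continuous.div (by fun_prop) (by fun_prop) fun z => (hmax z).ne')
      continuous_id
  have hPn : ∀ z, ‖P z‖ ≤ R := by
    intro z
    have := hmax z
    simp only [hP]
    rw [norm_smul, Real.norm_of_nonneg (by positivity), div_mul_eq_mul_div, div_le_iff₀ this]
    exact mul_le_mul_of_nonneg_left (le_max_right _ _) hR.le
  set S : E → E := fun x => P (T x + max 0 (r - ‖x‖) • φ) with hS
  obtain ⟨x, hx, hxS⟩ : ∃ x ∈ J ∩ Metric.closedBall 0 R, S x = x := by
    refine Convex.exists_fixedPoint_of_isCompact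
      (Q := (fun q : E × ℝ => P (q.1 + q.2 • φ)) '' (Q ×ˢ Icc 0 (max 0 r)))
      (hJc.inter (convex_closedBall _ _)) (hJcl.inter Metric.isClosed_closedBall)
      ⟨0, hJ0, by simp [hR.le]⟩ ?_ ?_ ((hQ.prod isCompact_Icc).image (by fun_prop)) ?_
    · exact hPc.comp_continuousOn ((hT.mono inter_subset_left).add
        (Continuous.continuousOn (by fun_prop)))
    · intro x hx
      refine ⟨hJsmul _ ?_ _ (hJadd _ (hTJ hx.1) _ (hJsmul _ (le_max_left _ _) _ hφ)), by
        simpa using hPn _⟩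
      have := hmax (T x + max 0 (r - ‖x‖) • φ)
      positivity
    · intro x hx
      refine ⟨(T x, max 0 (r - ‖x‖)), ⟨hTQ x hx.1 (by simpa using hx.2), le_max_left _ _, ?_⟩, rfl⟩
      exact max_le_max le_rfl (by linarith [norm_nonneg x])
  have hxR : ‖x‖ ≤ R := by simpa using hx.2
  set z := T x + max 0 (r - ‖x‖) • φ with hz
  have hxz : x = (R / max R ‖z‖) • z := hxS.symm
  have hTz : ‖z‖ ≤ R := by
    by_contra! hlt
    rw [max_eq_right hlt.le] at hxz
    have hxn : ‖x‖ = R := by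
      rw [hxz, norm_smul, Real.norm_of_nonneg (by positivity),
        div_mul_cancel₀ _ (hR.trans hlt).ne']
    have : z = T x := by
      rw [hz, hxn, max_eq_left (by linarith), zero_smul, add_zero]
    rw [this] at hlt
    exact hlt.not_ge (hTR x hx.1 hxn)
  rw [max_eq_left hTz, div_self hR.ne', one_smul] at hxz
  have hr : r ≤ ‖x‖ := by
    by_contra! hlt
    exact hTr x hx.1 hlt _ (lt_max_of_lt_right (sub_pos.2 hlt)) hxz
  rw [hz, max_eq_left (by linarith), zero_smul, add_zero] at hxz
  exact ⟨x, hx.1, hxz.symm, hr, hxR⟩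

/-- A measurable kernel on `[0,1]²` which is continuous in its first variable at each point for
almost every value of the second one, and dominated by an integrable function. -/
structure IsDominatedKernel (k : ℝ → ℝ → ℝ) (Φ : ℝ → ℝ) : Prop where
  measurable : Measurable (Function.uncurry k)
  continuousAt : ∀ t₀ : Icc (0 : ℝ) 1, ∀ᵐ s ∂(volume.restrict (Icc (0 : ℝ) 1)),
    ContinuousAt (fun t : Icc (0 : ℝ) 1 => k t s) t₀
  integrable : IntegrableOn Φ (Icc (0 : ℝ) 1)
  bound : ∀ t ∈ Icc (0 : ℝ) 1, ∀ᵐ s ∂(volume.restrict (Icc (0 : ℝ) 1)), |k t s| ≤ Φ s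

/-- The extension of a continuous function on `[0,1]` to the real line by constants. -/
noncomputable abbrev extendIcc (w : C(Icc (0 : ℝ) 1, ℝ)) (s : ℝ) : ℝ :=
  w (projIcc 0 1 zero_le_one s)

lemma continuous_extendIcc (w : C(Icc (0 : ℝ) 1, ℝ)) : Continuous (extendIcc w) :=
  w.continuous.comp continuous_projIcc

lemma extendIcc_of_mem (w : C(Icc (0 : ℝ) 1, ℝ)) {s : ℝ} (hs : s ∈ Icc (0 : ℝ) 1) :
    extendIcc w s = w ⟨s, hs⟩ := by
  rw [extendIcc, projIcc_of_mem]

lemma intervalIntegral_zero_one (g : ℝ → ℝ) :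
    ∫ s in (0 : ℝ)..1, g s = ∫ s in Icc (0 : ℝ) 1, g s := by
  rw [intervalIntegral.integral_of_le zero_le_one, integral_Icc_eq_integral_Ioc]

/-- The Hammerstein integral of a continuous function against a kernel. -/
noncomputable def kernelIntegral (k : ℝ → ℝ → ℝ) (w : C(Icc (0 : ℝ) 1, ℝ)) (t : ℝ) : ℝ :=
  ∫ s in (0 : ℝ)..1, k t s * extendIcc w s

lemma kernelIntegral_eq (k : ℝ → ℝ → ℝ) (w : C(Icc (0 : ℝ) 1, ℝ)) (t : ℝ) :
    kernelIntegral k w t = ∫ s in Icc (0 : ℝ) 1, k t s * extendIcc w s :=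
  intervalIntegral_zero_one _

namespace IsDominatedKernel

variable {k : ℝ → ℝ → ℝ} {Φ : ℝ → ℝ}

lemma integrable_kernel (hk : IsDominatedKernel k Φ) {t : ℝ} (ht : t ∈ Icc (0 : ℝ) 1) :
    IntegrableOn (k t) (Icc (0 : ℝ) 1) :=
  hk.integrable.mono' (hk.measurable.comp measurable_prodMk_left).aestronglyMeasurable
    (hk.bound t ht)

lemma integrable_mul (hk : IsDominatedKernel k Φ) (w : C(Icc (0 : ℝ) 1, ℝ)) {t : ℝ}
    (ht : t ∈ Icc (0 : ℝ) 1) : IntegrableOn (fun s => k t s * extendIcc w s) (Icc (0 : ℝ) 1) :=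
  (hk.integrable_kernel ht).mul_bdd (c := ‖w‖) (continuous_extendIcc w).aestronglyMeasurable
    (Filter.Eventually.of_forall fun _ => w.norm_coe_le_norm _)

lemma integral_abs_le (hk : IsDominatedKernel k Φ) {t : ℝ} (ht : t ∈ Icc (0 : ℝ) 1) :
    ∫ s in Icc (0 : ℝ) 1, |k t s| ≤ ∫ s in Icc (0 : ℝ) 1, Φ s :=
  integral_mono_ae (hk.integrable_kernel ht).abs hk.integrable (hk.bound t ht)

lemma abs_kernelIntegral_le (hk : IsDominatedKernel k Φ) (w : C(Icc (0 : ℝ) 1, ℝ)) {M : ℝ}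
    (hM : ∀ s, |w s| ≤ M) {t : ℝ} (ht : t ∈ Icc (0 : ℝ) 1) :
    |kernelIntegral k w t| ≤ M * ∫ s in Icc (0 : ℝ) 1, |k t s| := by
  rw [kernelIntegral_eq, ← integral_const_mul]
  refine (abs_integral_le_integral_abs).trans ?_
  refine integral_mono (hk.integrable_mul w ht).abs ((hk.integrable_kernel ht).abs.const_mul M)
    fun s => ?_
  simp only
  rw [abs_mul, mul_comm]
  exact mul_le_mul_of_nonneg_right (hM _) (abs_nonneg _)

lemma abs_kernelIntegral_sub_le (hk : IsDominatedKernel k Φ) (w : C(Icc (0 : ℝ) 1, ℝ))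
    {t t' : ℝ} (ht : t ∈ Icc (0 : ℝ) 1) (ht' : t' ∈ Icc (0 : ℝ) 1) :
    |kernelIntegral k w t - kernelIntegral k w t'| ≤
      ‖w‖ * ∫ s in Icc (0 : ℝ) 1, |k t s - k t' s| := by
  rw [kernelIntegral_eq, kernelIntegral_eq, ← integral_const_mul,
    ← integral_sub (hk.integrable_mul w ht) (hk.integrable_mul w ht')]
  refine (abs_integral_le_integral_abs).trans ?_
  refine integral_mono ((hk.integrable_mul w ht).sub (hk.integrable_mul w ht')).abs
    (((hk.integrable_kernel ht).sub (hk.integrable_kernel ht')).abs.const_mul ‖w‖) fun s => ?_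
  simp only
  rw [← sub_mul, abs_mul, mul_comm]
  exact mul_le_mul_of_nonneg_right (w.norm_coe_le_norm _) (abs_nonneg _)

lemma tendsto_integral_abs_sub (hk : IsDominatedKernel k Φ) (t₀ : Icc (0 : ℝ) 1) :
    Filter.Tendsto (fun t : Icc (0 : ℝ) 1 => ∫ s in Icc (0 : ℝ) 1, |k t s - k t₀ s|)
      (nhds t₀) (nhds 0) := by
  have h : ContinuousAt (fun t : Icc (0 : ℝ) 1 => ∫ s in Icc (0 : ℝ) 1, |k t s - k t₀ s|) t₀ := by
    refine continuousAt_of_dominated (bound := fun s => Φ s + Φ s) ?_ ?_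
      (hk.integrable.add hk.integrable) ?_
    · exact Filter.Eventually.of_forall fun t =>
        ((hk.integrable_kernel t.2).sub (hk.integrable_kernel t₀.2)).abs.aestronglyMeasurable
    · refine Filter.Eventually.of_forall fun t => ?_
      filter_upwards [hk.bound t t.2, hk.bound t₀ t₀.2] with s h1 h2
      rw [Real.norm_eq_abs, abs_abs]
      exact (abs_sub _ _).trans (add_le_add h1 h2)
    · filter_upwards [hk.continuousAt t₀] with s hs
      exact (hs.sub continuousAt_const).abs
  simpa [ContinuousAt] using h

/-- The Hammerstein operator on `C[0,1]` with a dominated kernel. -/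
noncomputable def toCLM (hk : IsDominatedKernel k Φ) :
    C(Icc (0 : ℝ) 1, ℝ) →L[ℝ] C(Icc (0 : ℝ) 1, ℝ) :=
  LinearMap.mkContinuous
    { toFun := fun w => ⟨fun t => kernelIntegral k w t, by
        refine continuous_iff_continuousAt.2 fun t₀ => ?_
        refine tendsto_iff_dist_tendsto_zero.2 (squeeze_zero (fun _ => dist_nonneg)
          (fun t => hk.abs_kernelIntegral_sub_le w t.2 t₀.2) ?_)
        simpa using (hk.tendsto_integral_abs_sub t₀).const_mul ‖w‖⟩
      map_add' := fun w w' => by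
        ext t
        simp only [ContinuousMap.coe_mk, ContinuousMap.add_apply, kernelIntegral_eq]
        rw [← integral_add (hk.integrable_mul w t.2) (hk.integrable_mul w' t.2)]
        simp only [extendIcc, mul_add]
      map_smul' := fun c w => by
        ext t
        simp only [ContinuousMap.coe_mk, ContinuousMap.smul_apply, kernelIntegral_eq,
          RingHom.id_apply, smul_eq_mul]
        rw [← integral_const_mul]
        simp only [extendIcc, mul_left_comm] }
    (∫ s in Icc (0 : ℝ) 1, Φ s) fun w => by
      have h0 : 0 ≤ ∫ s in Icc (0 : ℝ) 1, Φ s :=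
        (integral_nonneg fun _ => abs_nonneg _).trans
          (hk.integral_abs_le (left_mem_Icc.2 zero_le_one))
      refine (ContinuousMap.norm_le _ (by positivity)).2 fun t => ?_
      refine (hk.abs_kernelIntegral_le w (fun s => w.norm_coe_le_norm s) t.2).trans ?_
      rw [mul_comm]
      exact mul_le_mul_of_nonneg_right (hk.integral_abs_le t.2) (norm_nonneg _)

@[simp] lemma toCLM_apply (hk : IsDominatedKernel k Φ) (w : C(Icc (0 : ℝ) 1, ℝ))
    (t : Icc (0 : ℝ) 1) : hk.toCLM w t = kernelIntegral k w t := rfl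

lemma isCompactOperator_toCLM (hk : IsDominatedKernel k Φ) : IsCompactOperator hk.toCLM := by
  have := isCompactOperator_iff_image_closedBall_subset_compact
    (hk.toCLM : C(Icc (0 : ℝ) 1, ℝ) →ₗ[ℝ] C(Icc (0 : ℝ) 1, ℝ)) one_pos
  refine this.2 ?_
  set e := ContinuousMap.isometryEquivBoundedOfCompact (Icc (0 : ℝ) 1) ℝ
  set A := e '' (hk.toCLM '' Metric.closedBall 0 1) with hA
  have hAcpt : IsCompact (closure A) := by
    refine BoundedContinuousFunction.arzela_ascoli (Metric.closedBall 0 ‖hk.toCLM‖)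
      (isCompact_closedBall _ _) A ?_ ?_
    · rintro _ t ⟨_, ⟨w, hw, rfl⟩, rfl⟩
      rw [mem_closedBall_zero_iff] at hw ⊢
      exact ((hk.toCLM w).norm_coe_le_norm t).trans
        ((hk.toCLM.le_opNorm w).trans (mul_le_of_le_one_right (norm_nonneg _) hw))
    · intro t₀
      refine Metric.equicontinuousAt_of_continuity_modulus _ (hk.tendsto_integral_abs_sub t₀) _
        (Filter.Eventually.of_forall ?_)
      rintro t ⟨_, _, ⟨w, hw, rfl⟩, rfl⟩
      rw [dist_comm]
      refine (hk.abs_kernelIntegral_sub_le w t.2 t₀.2).trans ?_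
      rw [mem_closedBall_zero_iff] at hw
      exact mul_le_of_le_one_left (integral_nonneg fun _ => abs_nonneg _) hw
  refine ⟨e.symm '' closure A, hAcpt.image e.symm.continuous, ?_⟩
  rintro _ ⟨w, hw, rfl⟩
  exact ⟨e (hk.toCLM w), subset_closure ⟨_, ⟨w, hw, rfl⟩, rfl⟩, e.symm_apply_apply _⟩

lemma kernelIntegral_mono (hk : IsDominatedKernel k Φ)
    (h0 : ∀ t ∈ Icc (0 : ℝ) 1, ∀ s ∈ Icc (0 : ℝ) 1, 0 ≤ k t s) {w w' : C(Icc (0 : ℝ) 1, ℝ)}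
    (hw : ∀ s, w s ≤ w' s) {t : ℝ} (ht : t ∈ Icc (0 : ℝ) 1) :
    kernelIntegral k w t ≤ kernelIntegral k w' t := by
  rw [kernelIntegral_eq, kernelIntegral_eq]
  exact setIntegral_mono_on (hk.integrable_mul w ht) (hk.integrable_mul w' ht) measurableSet_Icc
    fun s hs => mul_le_mul_of_nonneg_left (hw _) (h0 t ht s hs)

/-- Differentiation under the integral sign, in integrated form. -/
lemma kernelIntegral_eq_add_integral (hk : IsDominatedKernel k Φ) {k' : ℝ → ℝ → ℝ} {Φ' : ℝ → ℝ}
    (hk' : IsDominatedKernel k' Φ')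
    (hc : ∀ᵐ s ∂(volume.restrict (Icc (0 : ℝ) 1)),
      ContinuousOn (fun t => k t s) (Icc (0 : ℝ) 1))
    (hd : ∀ s ∈ Icc (0 : ℝ) 1, ∀ t ∈ Icc (0 : ℝ) 1, t ≠ s →
      HasDerivWithinAt (fun τ => k τ s) (k' t s) (Icc (0 : ℝ) 1) t)
    (w : C(Icc (0 : ℝ) 1, ℝ)) {t : ℝ} (ht : t ∈ Icc (0 : ℝ) 1) :
    kernelIntegral k w t = kernelIntegral k w 0 +
      ∫ τ in (0 : ℝ)..t, extendIcc (hk'.toCLM w) τ := by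
  have h0 : (0 : ℝ) ∈ Icc (0 : ℝ) 1 := left_mem_Icc.2 zero_le_one
  have hsub : Ioc 0 t ⊆ Icc (0 : ℝ) 1 := fun τ hτ => ⟨hτ.1.le, hτ.2.trans ht.2⟩
  have hswap : Integrable (fun q : ℝ × ℝ => k' q.1 q.2 * extendIcc w q.2)
      ((volume.restrict (Ioc 0 t)).prod (volume.restrict (Icc (0 : ℝ) 1))) := by
    have hmeas : AEStronglyMeasurable (fun q : ℝ × ℝ => k' q.1 q.2 * extendIcc w q.2)
        ((volume.restrict (Ioc 0 t)).prod (volume.restrict (Icc (0 : ℝ) 1))) :=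
      (hk'.measurable.mul ((continuous_extendIcc w).measurable.comp
        measurable_snd)).aestronglyMeasurable
    refine (integrable_prod_iff hmeas).2 ⟨?_, ?_⟩
    · filter_upwards [ae_restrict_mem measurableSet_Ioc] with τ hτ
      exact hk'.integrable_mul w (hsub hτ)
    · refine Integrable.mono' (g := fun _ => ‖w‖ * ∫ s in Icc (0 : ℝ) 1, Φ' s)
        (integrable_const _) hmeas.norm.integral_prod_right' ?_
      filter_upwards [ae_restrict_mem measurableSet_Ioc] with τ hτ
      rw [Real.norm_of_nonneg (integral_nonneg fun _ => norm_nonneg _)]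
      refine (integral_mono (hk'.integrable_mul w (hsub hτ)).norm
        ((hk'.integrable_kernel (hsub hτ)).abs.const_mul ‖w‖) fun s => ?_).trans ?_
      · simp only
        rw [norm_mul, mul_comm]
        exact mul_le_mul_of_nonneg_right (w.norm_coe_le_norm _) (abs_nonneg _)
      · rw [integral_const_mul]
        exact mul_le_mul_of_nonneg_left (hk'.integral_abs_le (hsub hτ)) (norm_nonneg _)
  have e1 : ∫ τ in (0 : ℝ)..t, extendIcc (hk'.toCLM w) τ =
      ∫ s in Icc (0 : ℝ) 1, ∫ τ in Ioc 0 t, k' τ s * extendIcc w s := by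
    rw [integral_integral_swap (f := fun s τ => k' τ s * extendIcc w s) hswap.swap,
      intervalIntegral.integral_of_le ht.1]
    refine setIntegral_congr_fun measurableSet_Ioc fun τ hτ => ?_
    rw [extendIcc_of_mem _ (hsub hτ), toCLM_apply, kernelIntegral_eq]
  rw [e1, ← sub_eq_iff_eq_add', kernelIntegral_eq, kernelIntegral_eq,
    ← integral_sub (hk.integrable_mul w ht) (hk.integrable_mul w h0)]
  refine integral_congr_ae ?_
  filter_upwards [hc, ae_restrict_mem measurableSet_Icc, hswap.prod_left_ae] with s hcs hs hint
  have hcw : ContinuousOn (fun τ => k τ s * extendIcc w s) (uIcc 0 t) := by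
    rw [uIcc_of_le ht.1]
    exact (hcs.mono (Icc_subset_Icc_right ht.2)).mul continuousOn_const
  rw [← intervalIntegral.integral_of_le ht.1,
    integral_eq_of_hasDerivAt_off_countable (fun τ => k τ s * extendIcc w s) _
      (countable_singleton s) hcw ?_ ?_]
  · intro τ hτ
    rw [min_eq_left ht.1, max_eq_right ht.1] at hτ
    have hτ1 : τ < 1 := hτ.1.2.trans_le ht.2
    exact ((hd s hs τ ⟨hτ.1.1.le, hτ1.le⟩ hτ.2).hasDerivAt
      (Icc_mem_nhds hτ.1.1 hτ1)).mul_const _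
  · exact (intervalIntegrable_iff_integrableOn_Ioc_of_le ht.1).2 hint

end IsDominatedKernel

lemma hasDerivWithinAt_of_eq_add_integral {g : ℝ → ℝ} {w : C(Icc (0 : ℝ) 1, ℝ)}
    (h : ∀ t ∈ Icc (0 : ℝ) 1, g t = g 0 + ∫ τ in (0 : ℝ)..t, extendIcc w τ) {t : ℝ}
    (ht : t ∈ Icc (0 : ℝ) 1) : HasDerivWithinAt g (extendIcc w t) (Icc 0 1) t := by
  have hc := continuous_extendIcc w
  have := ((intervalIntegral.integral_hasDerivAt_right (hc.intervalIntegrable 0 t)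
    (hc.stronglyMeasurableAtFilter _ _) hc.continuousAt).const_add (g 0)).hasDerivWithinAt
    (s := Icc 0 1)
  exact this.congr h (h t ht)

/-- Each entry of the tuple is a primitive of the next one. -/
def IsJet {m : ℕ} (y : Fin (m + 1) → C(Icc (0 : ℝ) 1, ℝ)) : Prop :=
  ∀ (l : Fin m) (t : Icc (0 : ℝ) 1),
    y l.castSucc t = y l.castSucc 0 + ∫ τ in (0 : ℝ)..t, extendIcc (y l.succ) τ

namespace IsJet

variable {m : ℕ} {y z : Fin (m + 1) → C(Icc (0 : ℝ) 1, ℝ)}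

lemma hasDerivWithinAt (hy : IsJet y) (l : Fin m) {t : ℝ} (ht : t ∈ Icc (0 : ℝ) 1) :
    HasDerivWithinAt (extendIcc (y l.castSucc)) (extendIcc (y l.succ) t) (Icc 0 1) t := by
  refine hasDerivWithinAt_of_eq_add_integral (fun t ht => ?_) ht
  rw [extendIcc_of_mem _ ht, extendIcc_of_mem _ (left_mem_Icc.2 zero_le_one)]
  exact hy l ⟨t, ht⟩

lemma iteratedDerivWithin_eq (hy : IsJet y) (l : Fin (m + 1)) :
    ∀ t ∈ Icc (0 : ℝ) 1,
      iteratedDerivWithin l (extendIcc (y 0)) (Icc 0 1) t = extendIcc (y l) t := by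
  induction l using Fin.induction with
  | zero => intro t _; simp
  | succ l ih =>
    intro t ht
    rw [Fin.val_succ, iteratedDerivWithin_succ]
    exact (derivWithin_congr ih (ih t ht)).trans
      ((hy.hasDerivWithinAt l ht).derivWithin (uniqueDiffOn_Icc zero_lt_one t ht))

lemma contDiffOn (hy : IsJet y) : ContDiffOn ℝ m (extendIcc (y 0)) (Icc 0 1) := by
  refine contDiffOn_of_continuousOn_differentiableOn_deriv (n := (m : ℕ∞)) (fun l hl => ?_)
    (fun l hl => ?_)
  · have hl' : l < m + 1 := Nat.lt_succ_of_le (by exact_mod_cast hl)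
    exact (continuous_extendIcc (y ⟨l, hl'⟩)).continuousOn.congr
      (hy.iteratedDerivWithin_eq ⟨l, hl'⟩)
  · have hl' : l < m := by exact_mod_cast hl
    intro t ht
    exact ((hy.hasDerivWithinAt ⟨l, hl'⟩ ht).differentiableWithinAt).congr
      (hy.iteratedDerivWithin_eq (Fin.castSucc ⟨l, hl'⟩))
      (hy.iteratedDerivWithin_eq (Fin.castSucc ⟨l, hl'⟩) t ht)

lemma normCm_eq (hy : IsJet y) : normCm m (extendIcc (y 0)) = ⨆ l, ‖y l‖ := by
  unfold normCm
  refine iSup_congr fun l => ?_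
  rw [ContinuousMap.norm_eq_iSup_norm]
  refine iSup_congr fun t => ?_
  rw [hy.iteratedDerivWithin_eq l t t.2, extendIcc_of_mem _ t.2, Real.norm_eq_abs]

lemma add (hy : IsJet y) (hz : IsJet z) : IsJet (y + z) := by
  intro l t
  have := intervalIntegral.integral_add
    ((continuous_extendIcc (y l.succ)).intervalIntegrable (μ := volume) 0 t)
    ((continuous_extendIcc (z l.succ)).intervalIntegrable 0 t)
  simp only [extendIcc] at this
  simp only [Pi.add_apply, ContinuousMap.add_apply, extendIcc, this, hy l t, hz l t]
  ring

lemma const_smul (hy : IsJet y) (c : ℝ) : IsJet (c • y) := by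
  intro l t
  simp only [Pi.smul_apply, ContinuousMap.smul_apply, extendIcc, smul_eq_mul, hy l t,
    intervalIntegral.integral_const_mul]
  ring

lemma sub (hy : IsJet y) (hz : IsJet z) : IsJet (y - z) := by
  simpa [sub_eq_add_neg] using hy.add (hz.const_smul (-1))

lemma zero : IsJet (0 : Fin (m + 1) → C(Icc (0 : ℝ) 1, ℝ)) := by
  intro l t
  simp [extendIcc]

lemma sum {ι : Type*} {s : Finset ι} {y : ι → Fin (m + 1) → C(Icc (0 : ℝ) 1, ℝ)}
    (hy : ∀ j ∈ s, IsJet (y j)) : IsJet (∑ j ∈ s, y j) := by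
  classical
  induction s using Finset.induction_on with
  | empty => simpa using zero
  | insert a s ha ih =>
    rw [Finset.sum_insert ha]
    exact (hy a (Finset.mem_insert_self a s)).add
      (ih fun j hj => hy j (Finset.mem_insert_of_mem hj))

lemma isClosed_setOf : IsClosed {y : Fin (m + 1) → C(Icc (0 : ℝ) 1, ℝ) | IsJet y} := by
  simp only [IsJet, ofPred_forall]
  refine isClosed_iInter fun l => isClosed_iInter fun t => isClosed_eq ?_ ?_
  · exact (continuous_eval_const t).comp (continuous_apply l.castSucc)
  · refine ((continuous_eval_const 0).comp (continuous_apply l.castSucc)).add ?_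
    refine intervalIntegral.continuous_parametric_intervalIntegral_of_continuous' ?_ _ _
    exact ((continuous_apply l.succ).comp continuous_fst).eval
      (continuous_projIcc.comp continuous_snd)

end IsJet

/-- The tuple of derivatives of a function of class `Cᵐ` on `[0,1]`. -/
noncomputable def jetOfContDiffOn {m : ℕ} {g : ℝ → ℝ} (hg : ContDiffOn ℝ m g (Icc 0 1))
    (l : Fin (m + 1)) : C(Icc (0 : ℝ) 1, ℝ) where
  toFun t := iteratedDerivWithin l g (Icc 0 1) t
  continuous_toFun := continuousOn_iff_continuous_domRestrict.1
    (hg.continuousOn_iteratedDerivWithin (by exact_mod_cast Nat.lt_succ_iff.1 l.2)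
      (uniqueDiffOn_Icc zero_lt_one))

lemma jetOfContDiffOn_apply {m : ℕ} {g : ℝ → ℝ} (hg : ContDiffOn ℝ m g (Icc 0 1))
    (l : Fin (m + 1)) (t : Icc (0 : ℝ) 1) :
    jetOfContDiffOn hg l t = iteratedDerivWithin l g (Icc 0 1) t := rfl

lemma isJet_jetOfContDiffOn {m : ℕ} {g : ℝ → ℝ} (hg : ContDiffOn ℝ m g (Icc 0 1)) :
    IsJet (jetOfContDiffOn hg) := by
  intro l t
  have hu := uniqueDiffOn_Icc (zero_lt_one (α := ℝ))
  have hcont := hg.continuousOn_iteratedDerivWithin (m := l) (by exact_mod_cast l.2.le) hu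
  have hdiff := hg.differentiableOn_iteratedDerivWithin (m := l) (by exact_mod_cast l.2) hu
  have key : ∫ τ in (0 : ℝ)..t, extendIcc (jetOfContDiffOn hg l.succ) τ =
      iteratedDerivWithin l g (Icc 0 1) t - iteratedDerivWithin l g (Icc 0 1) 0 := by
    refine intervalIntegral.integral_eq_sub_of_hasDerivAt_of_le t.2.1
      (hcont.mono (Icc_subset_Icc_right t.2.2)) (fun τ hτ => ?_)
      ((continuous_extendIcc _).intervalIntegrable _ _)
    have hτ' : τ ∈ Icc (0 : ℝ) 1 := ⟨hτ.1.le, hτ.2.le.trans t.2.2⟩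
    rw [extendIcc_of_mem _ hτ', jetOfContDiffOn_apply, Fin.val_succ, iteratedDerivWithin_succ]
    exact (hdiff τ hτ').hasDerivWithinAt.hasDerivAt (Icc_mem_nhds hτ.1 (hτ.2.trans_le t.2.2))
  rw [key, jetOfContDiffOn_apply, jetOfContDiffOn_apply]
  simp

lemma pi_norm_eq_iSup {ι : Type*} [Fintype ι] [Nonempty ι] {G : ι → Type*}
    [∀ i, SeminormedAddCommGroup (G i)] (x : ∀ i, G i) : ‖x‖ = ⨆ i, ‖x i‖ := by
  refine le_antisymm ?_ (ciSup_le (norm_le_pi_norm x))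
  have hb : BddAbove (range fun i => ‖x i‖) := (finite_range _).bddAbove
  exact (pi_norm_le_iff_of_nonempty _).2 fun i => le_ciSup hb i

lemma normP_eq_norm {n : ℕ} (hn : 0 < n) {m : Fin n → ℕ}
    {y : (i : Fin n) → Fin (m i + 1) → C(Icc (0 : ℝ) 1, ℝ)} (hy : ∀ i, IsJet (y i)) :
    normP m (fun i => extendIcc (y i 0)) = ‖y‖ := by
  have : Nonempty (Fin n) := ⟨⟨0, hn⟩⟩
  rw [pi_norm_eq_iSup, normP]
  refine iSup_congr fun i => ?_
  rw [(hy i).normCm_eq, pi_norm_eq_iSup]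

lemma jet_eq {n : ℕ} {m : Fin n → ℕ}
    {y : (i : Fin n) → Fin (m i + 1) → C(Icc (0 : ℝ) 1, ℝ)} (hy : ∀ i, IsJet (y i)) {t : ℝ}
    (ht : t ∈ Icc (0 : ℝ) 1) :
    jet m (fun i => extendIcc (y i 0)) t = fun j l => extendIcc (y j l) t := by
  ext j l
  exact (hy j).iteratedDerivWithin_eq l t ht

/-- A compact operator of spectral radius `ρ > 0` has an eigenvalue of modulus `ρ`. -/
lemma IsCompactOperator.exists_eigenvector_of_spectralRadius {E : Type*} [NormedAddCommGroup E]
    [NormedSpace ℝ E] [CompleteSpace E] {L : E →L[ℝ] E} (hL : IsCompactOperator L) {ρ : ℝ}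
    (hρ : 0 < ρ) (hLρ : spectralRadius ℝ L = ENNReal.ofReal ρ) :
    ∃ (ν : ℝ) (v : E), |ν| = ρ ∧ v ≠ 0 ∧ L v = ν • v := by
  have hne : (spectrum ℝ L).Nonempty := by
    by_contra hemp
    rw [not_nonempty_iff_eq_empty] at hemp
    have : spectralRadius ℝ L = 0 := by simp [spectralRadius, hemp]
    rw [this, eq_comm, ENNReal.ofReal_eq_zero] at hLρ
    exact hρ.not_ge hLρ
  obtain ⟨ν, hν, hνr⟩ := spectrum.exists_nnnorm_eq_spectralRadius_of_nonempty hne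
  have hνabs : |ν| = ρ := by
    have := congrArg ENNReal.toReal (hνr.trans hLρ)
    rwa [ENNReal.toReal_ofReal hρ.le, ENNReal.coe_toReal, coe_nnnorm, Real.norm_eq_abs] at this
  have hν0 : ν ≠ 0 := by
    rintro rfl
    rw [abs_zero] at hνabs
    exact hρ.ne hνabs
  obtain ⟨v, hv⟩ := ((hL.hasEigenvalue_iff_mem_spectrum hν0).2 hν).exists_hasEigenvector
  exact ⟨ν, v, hνabs, hv.2, hv.apply_eq_smul⟩

section PositiveOperator

variable {X : Type*} [TopologicalSpace X]

/-- A compact positive operator on `C(X)` of spectral radius `ρ > 0` has a nonzero nonnegative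
function `w` with `ρ w ≤ L w`. -/
lemma exists_nonneg_mul_le_of_spectralRadius [CompactSpace X] {L : C(X, ℝ) →L[ℝ] C(X, ℝ)}
    (hL : IsCompactOperator L) (hmono : ∀ w w' : C(X, ℝ), (∀ t, w t ≤ w' t) → ∀ t, L w t ≤ L w' t)
    {ρ : ℝ} (hρ : 0 < ρ) (hLρ : spectralRadius ℝ L = ENNReal.ofReal ρ) :
    ∃ w : C(X, ℝ), w ≠ 0 ∧ (∀ t, 0 ≤ w t) ∧ ∀ t, ρ * w t ≤ L w t := by
  obtain ⟨ν, v, hνabs, hv, hLv⟩ := hL.exists_eigenvector_of_spectralRadius hρ hLρ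
  refine ⟨|v|, fun h => hv (ContinuousMap.ext fun t => by simpa using DFunLike.congr_fun h t),
    fun t => abs_nonneg _, fun t => ?_⟩
  have h1 := hmono v |v| (fun s => le_abs_self _) t
  have h2 := hmono (-v) |v| (fun s => neg_le_abs _) t
  rw [map_neg, ContinuousMap.neg_apply] at h2
  rw [ContinuousMap.abs_apply, ← hνabs, ← abs_mul]
  rw [hLv] at h1 h2
  exact abs_le'.2 ⟨h1, h2⟩

lemma not_mul_apply_add_le_of_monotone {L : C(X, ℝ) →L[ℝ] C(X, ℝ)}
    (hmono : ∀ w w' : C(X, ℝ), (∀ t, w t ≤ w' t) → ∀ t, L w t ≤ L w' t)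
    {w : C(X, ℝ)} {ρ : ℝ} (hρ : 0 < ρ) (hw : w ≠ 0) (hw0 : ∀ t, 0 ≤ w t)
    (hwL : ∀ t, ρ * w t ≤ L w t) {y N : C(X, ℝ)} {a δ σ : ℝ} (hδ : 0 ≤ δ) (ha : 0 ≤ a)
    (haδ : 1 ≤ a * δ * ρ) (hσ : 0 < σ) (hy : ∀ t, 0 ≤ y t) (hN : ∀ t, δ * y t ≤ N t) :
    ¬ ∀ t, a * L N t + σ * L w t ≤ y t := by
  intro h
  have hLw0 : ∀ t, 0 ≤ L w t := fun t => (mul_nonneg hρ.le (hw0 t)).trans (hwL t)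
  have hLLw : ∀ t, ρ * L w t ≤ L (L w) t := by
    intro t
    simpa using hmono (ρ • w) (L w) (fun s => by simpa using hwL s) t
  have key : ∀ (k : ℕ) (t : X), k * σ * L w t ≤ y t := by
    intro k
    induction k with
    | zero => simpa using hy
    | succ k ih =>
      intro t
      have h1 : (δ * (k * σ)) * L (L w) t ≤ L N t := by
        have := hmono ((δ * (k * σ)) • L w) N (fun s => ?_) t
        · simpa using this
        · refine le_trans ?_ (hN s)
          simpa [mul_assoc] using mul_le_mul_of_nonneg_left (ih s) hδ
      have h2 : k * σ * L w t ≤ a * L N t := by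
        have hkσ : 0 ≤ k * σ := by positivity
        calc k * σ * L w t ≤ (a * δ * ρ) * (k * σ * L w t) :=
              le_mul_of_one_le_left (mul_nonneg hkσ (hLw0 t)) haδ
          _ = a * (δ * (k * σ) * (ρ * L w t)) := by ring
          _ ≤ a * (δ * (k * σ) * L (L w) t) := by
              have := hLLw t
              gcongr
          _ ≤ a * L N t := by gcongr
      have := h t
      push_cast
      linarith
  obtain ⟨t, ht⟩ : ∃ t, w t ≠ 0 := by
    by_contra! h0
    exact hw (ContinuousMap.ext h0)
  have hpos : 0 < σ * L w t :=
    mul_pos hσ ((mul_pos hρ ((hw0 t).lt_of_ne' ht)).trans_le (hwL t))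
  obtain ⟨k, hk⟩ := exists_nat_gt (y t / (σ * L w t))
  rw [div_lt_iff₀ hpos] at hk
  have := key k t
  linarith

end PositiveOperator

section System

variable {n : ℕ} {m p : Fin n → ℕ}

/-- Tuples of continuous functions indexed like the jets of elements of `∏ᵢ C^{m_i}[0,1]`. -/
abbrev JetSpace (m : Fin n → ℕ) : Type := (i : Fin n) → Fin (m i + 1) → C(Icc (0 : ℝ) 1, ℝ)

/-- The jets of the elements of the cone `P`. -/
def jetCone (m : Fin n → ℕ) : Set (JetSpace m) :=
  {y | ∀ i, IsJet (y i) ∧ ∀ t, 0 ≤ y i 0 t}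

lemma isClosed_jetCone : IsClosed (jetCone m) := by
  simp only [jetCone, ofPred_forall, ofPred_and]
  refine isClosed_iInter fun i => ?_
  have hi : Continuous fun y : JetSpace m => y i := continuous_apply i
  refine (IsJet.isClosed_setOf.preimage hi).inter (isClosed_iInter fun t => ?_)
  exact isClosed_le continuous_const
    ((continuous_eval_const t).comp ((continuous_apply 0).comp hi))

lemma zero_mem_jetCone : (0 : JetSpace m) ∈ jetCone m :=
  fun _ => ⟨IsJet.zero, fun _ => le_rfl⟩

lemma add_mem_jetCone {y z : JetSpace m} (hy : y ∈ jetCone m) (hz : z ∈ jetCone m) :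
    y + z ∈ jetCone m :=
  fun i => ⟨(hy i).1.add (hz i).1, fun t => add_nonneg ((hy i).2 t) ((hz i).2 t)⟩

lemma smul_mem_jetCone {c : ℝ} (hc : 0 ≤ c) {y : JetSpace m} (hy : y ∈ jetCone m) :
    c • y ∈ jetCone m :=
  fun i => ⟨(hy i).1.const_smul c, fun t => mul_nonneg hc ((hy i).2 t)⟩

lemma convex_jetCone : Convex ℝ (jetCone m) :=
  fun _ hy _ hz _ _ ha hb _ => add_mem_jetCone (smul_mem_jetCone ha hy) (smul_mem_jetCone hb hz)

/-- The tuple of functions underlying a tuple of jets. -/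
noncomputable def JetSpace.toFun (y : JetSpace m) (i : Fin n) : ℝ → ℝ := extendIcc (y i 0)

lemma memP_toFun {y : JetSpace m} (hy : y ∈ jetCone m) : memP m y.toFun :=
  ⟨fun i => (hy i).1.contDiffOn, fun i _ _ => (hy i).2 _⟩

lemma normP_toFun (hn : 0 < n) {y : JetSpace m} (hy : y ∈ jetCone m) : normP m y.toFun = ‖y‖ :=
  normP_eq_norm hn fun i => (hy i).1

lemma normP_toFun_sub (hn : 0 < n) {y z : JetSpace m} (hy : y ∈ jetCone m) (hz : z ∈ jetCone m) :
    normP m (fun i t => y.toFun i t - z.toFun i t) = ‖y - z‖ :=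
  normP_eq_norm (y := y - z) hn fun i => (hy i).1.sub (hz i).1

lemma jet_toFun {y : JetSpace m} (hy : y ∈ jetCone m) {t : ℝ} (ht : t ∈ Icc (0 : ℝ) 1) :
    jet m y.toFun t = fun j l => extendIcc (y j l) t :=
  jet_eq (fun i => (hy i).1) ht

lemma isCompact_Jset (ρ : ℝ) : IsCompact (Jset m ρ) := by
  have : Jset m ρ = univ.pi fun j => univ.pi fun l : Fin (m j + 1) =>
      if l = 0 then Icc 0 ρ else Icc (-ρ) ρ := by
    ext x
    simp only [Jset, mem_ofPred_eq, mem_univ_pi]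
    refine forall_congr' fun j => ⟨fun h l => ?_, fun h => ⟨by simpa using h 0, fun l hl => ?_⟩⟩
    · split_ifs with hl
      · exact hl ▸ h.1
      · exact h.2 l hl
    · simpa [hl] using h l
  rw [this]
  refine isCompact_univ_pi fun j => isCompact_univ_pi fun l => ?_
  split_ifs <;> exact isCompact_Icc

lemma apply_mem_Jset {y : JetSpace m} (hy : y ∈ jetCone m) {ρ : ℝ} (hρ : ‖y‖ ≤ ρ)
    (t : Icc (0 : ℝ) 1) : (fun j l => y j l t) ∈ Jset m ρ := by
  have hb : ∀ j l, |y j l t| ≤ ρ := fun j l =>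
    ((y j l).norm_coe_le_norm t).trans
      ((norm_le_pi_norm (y j) l).trans ((norm_le_pi_norm y j).trans hρ))
  exact fun j => ⟨⟨(hy j).2 t, (abs_le.1 (hb j 0)).2⟩, fun l _ => abs_le.1 (hb j l)⟩

/-- The superposition operator of a function on `[0,1] × ∏ⱼ ([0,∞) × ℝ^{m_j})`, where negative
values in the zeroth slots are replaced by `0`. -/
noncomputable def nemytskii {F : ℝ × ((j : Fin n) → Fin (m j + 1) → ℝ) → ℝ}
    (hF : ContinuousOn F (Icc (0 : ℝ) 1 ×ˢ {x | ∀ j, 0 ≤ x j 0})) (y : JetSpace m) :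
    C(Icc (0 : ℝ) 1, ℝ) where
  toFun s := F (s, fun j l => if l = 0 then max 0 (y j l s) else y j l s)
  continuous_toFun := by
    refine hF.comp_continuous ?_ fun s => ⟨s.2, fun j => by simp⟩
    refine continuous_subtype_val.prodMk (continuous_pi fun j => continuous_pi fun l => ?_)
    split_ifs <;> fun_prop

variable {F : ℝ × ((j : Fin n) → Fin (m j + 1) → ℝ) → ℝ}
  (hF : ContinuousOn F (Icc (0 : ℝ) 1 ×ˢ {x | ∀ j, 0 ≤ x j 0}))

lemma continuous_nemytskii : Continuous (nemytskii hF) := by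
  refine ContinuousMap.continuous_of_continuous_uncurry _ ?_
  refine hF.comp_continuous (f := fun q : JetSpace m × Icc (0 : ℝ) 1 =>
    ((q.2 : ℝ), fun j l => if l = 0 then max 0 (q.1 j l q.2) else q.1 j l q.2)) ?_
    fun q => ⟨q.2.2, fun j => by simp⟩
  refine (continuous_subtype_val.comp continuous_snd).prodMk
    (continuous_pi fun j => continuous_pi fun l => ?_)
  have hjl : Continuous fun q : JetSpace m × Icc (0 : ℝ) 1 => q.1 j l := by fun_prop
  have := hjl.eval continuous_snd
  split_ifs
  · exact continuous_const.max this
  · exact this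

lemma nemytskii_apply {y : JetSpace m} (hy : y ∈ jetCone m) (s : Icc (0 : ℝ) 1) :
    nemytskii hF y s = F (s, fun j l => y j l s) := by
  refine congrArg F (Prod.ext rfl ?_)
  ext j l
  simp only
  split_ifs with hl
  · subst hl
    exact max_eq_right ((hy j).2 s)
  · rfl

/-- The perturbed Hammerstein operator, together with its derivatives. -/
noncomputable def hammersteinMap
    (G : (i : Fin n) → Fin (m i + 1) → C(Icc (0 : ℝ) 1, ℝ) →L[ℝ] C(Icc (0 : ℝ) 1, ℝ))
    (N : Fin n → JetSpace m → C(Icc (0 : ℝ) 1, ℝ)) (c : (i : Fin n) → Fin (p i) → JetSpace m → ℝ)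
    (Γ : (i : Fin n) → Fin (p i) → Fin (m i + 1) → C(Icc (0 : ℝ) 1, ℝ)) (y : JetSpace m) :
    JetSpace m :=
  fun i => (fun l => G i l (N i y)) + ∑ j, c i j y • Γ i j

section hammersteinMap

variable {G : (i : Fin n) → Fin (m i + 1) → C(Icc (0 : ℝ) 1, ℝ) →L[ℝ] C(Icc (0 : ℝ) 1, ℝ)}
  {N : Fin n → JetSpace m → C(Icc (0 : ℝ) 1, ℝ)} {c : (i : Fin n) → Fin (p i) → JetSpace m → ℝ}
  {Γ : (i : Fin n) → Fin (p i) → Fin (m i + 1) → C(Icc (0 : ℝ) 1, ℝ)} {s : Set (JetSpace m)}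

lemma hammersteinMap_apply (y : JetSpace m) (i : Fin n) (l : Fin (m i + 1)) :
    hammersteinMap G N c Γ y i l = G i l (N i y) + ∑ j, c i j y • Γ i j l := by
  simp [hammersteinMap]

lemma hammersteinMap_apply_apply (y : JetSpace m) (i : Fin n) (l : Fin (m i + 1))
    (t : Icc (0 : ℝ) 1) :
    hammersteinMap G N c Γ y i l t = G i l (N i y) t + ∑ j, c i j y * Γ i j l t := by
  simp [hammersteinMap_apply, ContinuousMap.sum_apply]

lemma continuousOn_hammersteinMap (hN : ∀ i, ContinuousOn (N i) s)
    (hc : ∀ i j, ContinuousOn (c i j) s) : ContinuousOn (hammersteinMap G N c Γ) s := by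
  refine continuousOn_pi.2 fun i => continuousOn_pi.2 fun l => ?_
  simp only [hammersteinMap_apply]
  exact ((G i l).continuous.comp_continuousOn (hN i)).add
    (continuousOn_finsetSum _ fun j _ => (hc i j).smul continuousOn_const)

lemma exists_isCompact_mapsTo_hammersteinMap (hG : ∀ i l, IsCompactOperator (G i l))
    {M : Fin n → ℝ} (hN : ∀ i, ∀ y ∈ s, ‖N i y‖ ≤ M i) {C : (i : Fin n) → Fin (p i) → ℝ}
    (hc : ∀ i j, ∀ y ∈ s, |c i j y| ≤ C i j) :
    ∃ Q, IsCompact Q ∧ MapsTo (hammersteinMap G N c Γ) s Q := by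
  choose K hK hGK using fun i l => (hG i l).image_closedBall_subset_compact (M i)
  refine ⟨univ.pi fun i => univ.pi fun l =>
    (fun q : C(Icc (0 : ℝ) 1, ℝ) × (Fin (p i) → ℝ) => q.1 + ∑ j, q.2 j • Γ i j l) ''
      (K i l ×ˢ univ.pi fun j => Icc (-C i j) (C i j)), ?_, ?_⟩
  · refine isCompact_univ_pi fun i => isCompact_univ_pi fun l => ?_
    exact ((hK i l).prod (isCompact_univ_pi fun j => isCompact_Icc)).image (by fun_prop)
  · intro y hy i _ l _
    refine ⟨(G i l (N i y), fun j => c i j y), ⟨hGK i l ⟨_, ?_, rfl⟩, fun j _ => ?_⟩, ?_⟩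
    · simpa using hN i y hy
    · exact abs_le.1 (hc i j y hy)
    · rw [hammersteinMap_apply]

end hammersteinMap

end System

/-- Theorem 2.2 of the paper: under `(C₁)–(C₈)`, if there are
`0 < r < R` and `δ > 0` and an index `i₀` such that the growth condition
`(idx1)` holds at `R` and the eigenvalue-comparison condition `(idx0)` holds at
`r`, then the system of perturbed Hammerstein integral equations has a solution
`u ∈ P` with `r ≤ ‖u‖ ≤ R`. -/
theorem stmt_0
    (n : ℕ) (hn : 0 < n) (m p : Fin n → ℕ)
    (hm : ∀ i, 1 ≤ m i) (hp : ∀ i, 1 ≤ p i)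
    -- `dk i l t s` denotes `∂ˡk_i/∂tˡ(t,s)`; in particular `dk i 0` is the kernel `k_i`
    (dk : (i : Fin n) → ℕ → ℝ → ℝ → ℝ)
    -- (C₁): `k_i ≥ 0`, measurable, continuous in `t` for a.e. `s`, dominated by `Φ_{i0} ∈ L¹`
    -- (C₂)-(C₃): similarly for the derivatives, the `m_i`-th one off the diagonal only
    (hk_nonneg : ∀ i, ∀ t ∈ Set.Icc (0:ℝ) 1, ∀ s ∈ Set.Icc (0:ℝ) 1, 0 ≤ dk i 0 t s)
    (hk_meas : ∀ i, ∀ l ≤ m i, Measurable (Function.uncurry (dk i l)))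
    (hk_cont : ∀ i, ∀ l < m i, ∀ᵐ s ∂(volume.restrict (Set.Icc (0:ℝ) 1)),
      ContinuousOn (fun t => dk i l t s) (Set.Icc (0:ℝ) 1))
    (hk_cont_top : ∀ i, ∀ᵐ s ∂(volume.restrict (Set.Icc (0:ℝ) 1)),
      ContinuousOn (fun t => dk i (m i) t s) (Set.Icc (0:ℝ) 1 \ {s}))
    (Φ : (i : Fin n) → ℕ → ℝ → ℝ)
    (hΦ_int : ∀ i, ∀ l ≤ m i, IntegrableOn (Φ i l) (Set.Icc (0:ℝ) 1))
    (hΦ_dom : ∀ i, ∀ l ≤ m i, ∀ t ∈ Set.Icc (0:ℝ) 1,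
      ∀ᵐ s ∂(volume.restrict (Set.Icc (0:ℝ) 1)), |dk i l t s| ≤ Φ i l s)
    (hk_deriv : ∀ i, ∀ l, l + 1 < m i → ∀ s ∈ Set.Icc (0:ℝ) 1, ∀ t ∈ Set.Icc (0:ℝ) 1,
      HasDerivWithinAt (fun τ => dk i l τ s) (dk i (l + 1) t s) (Set.Icc (0:ℝ) 1) t)
    (hk_deriv_top : ∀ i, ∀ s ∈ Set.Icc (0:ℝ) 1, ∀ t ∈ Set.Icc (0:ℝ) 1, t ≠ s →
      HasDerivWithinAt (fun τ => dk i (m i - 1) τ s) (dk i (m i) t s) (Set.Icc (0:ℝ) 1) t)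
    -- (C₄): the nonlinearities `f_i` are continuous and nonnegative
    (f : (i : Fin n) → ℝ → ((j : Fin n) → Fin (m j + 1) → ℝ) → ℝ)
    (hf_cont : ∀ i, ContinuousOn
      (fun q : ℝ × ((j : Fin n) → Fin (m j + 1) → ℝ) => f i q.1 q.2)
      (Set.Icc (0:ℝ) 1 ×ˢ {x : (j : Fin n) → Fin (m j + 1) → ℝ | ∀ j, 0 ≤ x j 0}))
    (hf_nonneg : ∀ i, ∀ t ∈ Set.Icc (0:ℝ) 1,
      ∀ x : (j : Fin n) → Fin (m j + 1) → ℝ, (∀ j, 0 ≤ x j 0) → 0 ≤ f i t x)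
    -- (C₅): `γ_{ij} ∈ C^{m_i}[0,1]` nonnegative; (C₆): nonnegative parameters
    (γ : (i : Fin n) → Fin (p i) → ℝ → ℝ)
    (hγ_smooth : ∀ i j, ContDiffOn ℝ (m i) (γ i j) (Set.Icc 0 1))
    (hγ_nonneg : ∀ i j, ∀ t ∈ Set.Icc (0:ℝ) 1, 0 ≤ γ i j t)
    (lam : Fin n → ℝ) (η : (i : Fin n) → Fin (p i) → ℝ)
    (hlam : ∀ i, 0 ≤ lam i) (hη : ∀ i j, 0 ≤ η i j)
    -- (C₈): the functionals `h_{ij} : P → [0,∞)` are continuous and map bounded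
    -- sets into bounded sets
    (h : (i : Fin n) → Fin (p i) → (Fin n → ℝ → ℝ) → ℝ)
    (hh_nonneg : ∀ i j, ∀ u, memP m u → 0 ≤ h i j u)
    (hh_cont : ∀ i j, ∀ u, memP m u → ∀ ε > (0:ℝ), ∃ δ' > (0:ℝ), ∀ v, memP m v →
      normP m (fun i' t => u i' t - v i' t) < δ' → |h i j u - h i j v| < ε)
    (hh_bdd : ∀ i j, ∀ B : ℝ, ∃ C : ℝ, ∀ u, memP m u → normP m u ≤ B → h i j u ≤ C)
    -- (C₇): the Hammerstein operator `L_i w(t) = ∫₀¹ k_i(t,s)w(s)ds` on `C[0,1]`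
    -- has spectral radius `r(L_i) = rL i > 0`; its characteristic value is `μ_i = (rL i)⁻¹`
    (L : (i : Fin n) → C(Set.Icc (0:ℝ) 1, ℝ) →L[ℝ] C(Set.Icc (0:ℝ) 1, ℝ))
    (hL : ∀ i (w : C(Set.Icc (0:ℝ) 1, ℝ)) (t : Set.Icc (0:ℝ) 1),
      L i w t = ∫ s in (0:ℝ)..1, dk i 0 ↑t s * w (Set.projIcc 0 1 zero_le_one s))
    (rL : Fin n → ℝ) (hrL_pos : ∀ i, 0 < rL i)
    (hrL : ∀ i, spectralRadius ℝ (L i) = ENNReal.ofReal (rL i))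
    (r R δ : ℝ) (hr : 0 < r) (hrR : r < R) (hδ : 0 < δ) (i₀ : Fin n)
    (hidx1 : ∀ i, ∀ l ≤ m i,
      lam i * (sSup ((fun q : ℝ × ((j : Fin n) → Fin (m j + 1) → ℝ) => f i q.1 q.2) ''
        (Set.Icc (0:ℝ) 1 ×ˢ Jset m R))) *
        (sSup ((fun t : ℝ => ∫ s in (0:ℝ)..1,
          if l = 0 then dk i 0 t s else |dk i l t s|) '' Set.Icc (0:ℝ) 1)) +
      ∑ j, η i j * (supIcc (iteratedDerivWithin l (γ i j) (Set.Icc 0 1))) *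
        (sSup (h i j '' {u : Fin n → ℝ → ℝ | memP m u ∧ normP m u = R})) ≤ R)
    (hidx0a : (rL i₀)⁻¹ / δ ≤ lam i₀)
    (hidx0b : ∀ t ∈ Set.Icc (0:ℝ) 1, ∀ x ∈ Jset m r, δ * x i₀ 0 ≤ f i₀ t x) :
    ∃ u : Fin n → ℝ → ℝ, memP m u ∧
      (∀ i, ∀ t ∈ Set.Icc (0:ℝ) 1,
        u i t = lam i * (∫ s in (0:ℝ)..1, dk i 0 t s * f i s (jet m u s)) + ∑ j, η i j * γ i j t * h i j u) ∧
      r ≤ normP m u ∧ normP m u ≤ R := by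
  have hker : ∀ i, ∀ l ≤ m i, IsDominatedKernel (dk i l) (Φ i l) := by
    refine fun i l hl => ⟨hk_meas i l hl, fun t₀ => ?_, hΦ_int i l hl, hΦ_dom i l hl⟩
    rcases hl.lt_or_eq with hl | rfl
    · filter_upwards [hk_cont i l hl] with s hs
      exact (continuousOn_iff_continuous_domRestrict.1 hs).continuousAt
    · have hne : ∀ᵐ s ∂(volume.restrict (Icc (0 : ℝ) 1)), s ≠ (t₀ : ℝ) :=
        ae_restrict_of_ae (Measure.ae_ne volume (t₀ : ℝ))
      filter_upwards [hk_cont_top i, hne] with s hs hst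
      have h1 : ContinuousWithinAt (fun t => dk i (m i) t s) (Icc 0 1) t₀ :=
        (hs t₀ ⟨t₀.2, hst.symm⟩).mono_of_mem_nhdsWithin
          (inter_mem_nhdsWithin _ (isOpen_ne.mem_nhds hst.symm))
      exact (continuousWithinAt_iff_continuousAt_domRestrict _ t₀.2).1 h1
  have hderiv : ∀ i, ∀ l < m i, ∀ s ∈ Icc (0 : ℝ) 1, ∀ t ∈ Icc (0 : ℝ) 1, t ≠ s →
      HasDerivWithinAt (fun τ => dk i l τ s) (dk i (l + 1) t s) (Icc (0 : ℝ) 1) t := by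
    intro i l hl s hs t ht hts
    rcases (Nat.succ_le_of_lt hl).lt_or_eq with hl | hl
    · exact hk_deriv i l hl s hs t ht
    · have := hk_deriv_top i s hs t ht hts
      rwa [← hl, Nat.succ_sub_one] at this
  set G : (i : Fin n) → Fin (m i + 1) → C(Icc (0 : ℝ) 1, ℝ) →L[ℝ] C(Icc (0 : ℝ) 1, ℝ) :=
    fun i l => (hker i l (Nat.lt_succ_iff.1 l.2)).toCLM
  have hGcpt : ∀ i l, IsCompactOperator (G i l) := fun i l =>
    (hker i l (Nat.lt_succ_iff.1 l.2)).isCompactOperator_toCLM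
  have hGjet : ∀ i w, IsJet fun l => G i l w := fun i w l t =>
    (hker i l l.2.le).kernelIntegral_eq_add_integral (hker i (l + 1) l.2) (hk_cont i l l.2)
      (hderiv i l l.2) w t.2
  have hGmono : ∀ i (w w' : C(Icc (0 : ℝ) 1, ℝ)), (∀ t, w t ≤ w' t) →
      ∀ t, G i 0 w t ≤ G i 0 w' t := fun i w w' hw t =>
    (hker i 0 (Nat.zero_le _)).kernelIntegral_mono (hk_nonneg i) hw t.2
  have hGnonneg : ∀ i (w : C(Icc (0 : ℝ) 1, ℝ)), (∀ t, 0 ≤ w t) → ∀ t, 0 ≤ G i 0 w t := by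
    intro i w hw t
    simpa using hGmono i 0 w hw t
  have hLG : L i₀ = G i₀ 0 := by
    ext w t
    exact hL i₀ w t
  set N : Fin n → JetSpace m → C(Icc (0 : ℝ) 1, ℝ) :=
    fun i y => lam i • nemytskii (hf_cont i) y with hN
  set c : (i : Fin n) → Fin (p i) → JetSpace m → ℝ := fun i j y => η i j * h i j y.toFun with hc
  set Γ : (i : Fin n) → Fin (p i) → Fin (m i + 1) → C(Icc (0 : ℝ) 1, ℝ) :=
    fun i j => jetOfContDiffOn (hγ_smooth i j) with hΓ
  set T : JetSpace m → JetSpace m := hammersteinMap G N c Γ with hT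
  have hfnonneg : ∀ i, ∀ y ∈ jetCone m, ∀ t, 0 ≤ nemytskii (hf_cont i) y t := by
    intro i y hy t
    rw [nemytskii_apply _ hy]
    exact hf_nonneg i t t.2 _ fun j => (hy j).2 t
  have hNnonneg : ∀ i, ∀ y ∈ jetCone m, ∀ t, 0 ≤ N i y t := fun i y hy t =>
    mul_nonneg (hlam i) (hfnonneg i y hy t)
  have hcnonneg : ∀ i j, ∀ y ∈ jetCone m, 0 ≤ c i j y := fun i j y hy =>
    mul_nonneg (hη i j) (hh_nonneg i j _ (memP_toFun hy))
  have hΓ0 : ∀ i j t, Γ i j 0 t = γ i j t := by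
    intro i j t
    simp [hΓ, jetOfContDiffOn_apply]
  have hcΓ : ∀ i, ∀ y ∈ jetCone m, ∀ t, 0 ≤ ∑ j, c i j y * Γ i j 0 t := by
    refine fun i y hy t => Finset.sum_nonneg fun j _ => mul_nonneg (hcnonneg i j y hy) ?_
    rw [hΓ0]
    exact hγ_nonneg i j t t.2
  have hTJ : MapsTo T (jetCone m) (jetCone m) := by
    refine fun y hy i => ⟨(hGjet i _).add (IsJet.sum fun j _ =>
      (isJet_jetOfContDiffOn _).const_smul _), fun t => ?_⟩
    rw [hT, hammersteinMap_apply_apply]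
    exact add_nonneg (hGnonneg i _ (hNnonneg i y hy) t) (hcΓ i y hy t)
  have hTc : ContinuousOn T (jetCone m) := by
    refine continuousOn_hammersteinMap
      (fun i => ((continuous_nemytskii (hf_cont i)).const_smul (lam i)).continuousOn) fun i j => ?_
    refine continuousOn_const.mul (Metric.continuousOn_iff.2 fun y hy ε hε => ?_)
    obtain ⟨d, hd, hyd⟩ := hh_cont i j _ (memP_toFun hy) ε hε
    refine ⟨d, hd, fun z hz hzy => ?_⟩
    rw [dist_comm, Real.dist_eq]
    refine hyd _ (memP_toFun hz) ?_
    rwa [normP_toFun_sub hn hy hz, ← dist_eq_norm, dist_comm]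
  set fmax : Fin n → ℝ := fun i => sSup ((fun q : ℝ × ((j : Fin n) → Fin (m j + 1) → ℝ) =>
    f i q.1 q.2) '' (Icc (0 : ℝ) 1 ×ˢ Jset m R))
  have hnem : ∀ i, ∀ y ∈ jetCone m, ‖y‖ ≤ R → ∀ t, nemytskii (hf_cont i) y t ≤ fmax i := by
    intro i y hy hyR t
    rw [nemytskii_apply _ hy]
    have hcpt : IsCompact (Icc (0 : ℝ) 1 ×ˢ Jset m R) := isCompact_Icc.prod (isCompact_Jset R)
    refine le_csSup ((hcpt.image_of_continuousOn ((hf_cont i).mono ?_)).bddAbove)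
      ⟨(t, fun j l => y j l t), ⟨t.2, apply_mem_Jset hy hyR t⟩, rfl⟩
    exact prod_mono_right fun x hx j => (hx j).1.1
  have hNle : ∀ i, ∀ y ∈ jetCone m, ‖y‖ ≤ R → ∀ t, |N i y t| ≤ lam i * fmax i := by
    intro i y hy hyR t
    rw [abs_of_nonneg (hNnonneg i y hy t)]
    exact mul_le_mul_of_nonneg_left (hnem i y hy hyR t) (hlam i)
  choose C hC using fun i j => hh_bdd i j R
  obtain ⟨Q, hQ, hTQ⟩ : ∃ Q, IsCompact Q ∧ MapsTo T (jetCone m ∩ {y | ‖y‖ ≤ R}) Q := by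
    refine exists_isCompact_mapsTo_hammersteinMap hGcpt (M := fun i => lam i * fmax i)
      (C := fun i j => η i j * C i j) ?_ ?_
    · rintro i y ⟨hy, hyR⟩
      exact (ContinuousMap.norm_le_of_nonempty _).2 (hNle i y hy hyR)
    · rintro i j y ⟨hy, hyR⟩
      rw [abs_of_nonneg (hcnonneg i j y hy)]
      exact mul_le_mul_of_nonneg_left
        (hC i j _ (memP_toFun hy) ((normP_toFun hn hy).trans_le hyR)) (hη i j)
  have hTR : ∀ y ∈ jetCone m, ‖y‖ = R → ‖T y‖ ≤ R := by
    intro y hy hyR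
    have hR0 : 0 ≤ R := (hr.trans hrR).le
    refine (pi_norm_le_iff_of_nonneg hR0).2 fun i => (pi_norm_le_iff_of_nonneg hR0).2 fun l =>
      (ContinuousMap.norm_le _ hR0).2 fun t => ?_
    have hl : (l : ℕ) ≤ m i := Nat.lt_succ_iff.1 l.2
    rw [hT, hammersteinMap_apply_apply]
    refine (abs_add_le _ _).trans (le_trans (add_le_add ?_ ?_) (hidx1 i l hl))
    · refine ((hker i l hl).abs_kernelIntegral_le _ (hNle i y hy hyR.le) t.2).trans ?_
      have hK : ∀ t ∈ Icc (0 : ℝ) 1,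
          (∫ s in (0 : ℝ)..1, if (l : ℕ) = 0 then dk i 0 t s else |dk i l t s|) =
            ∫ s in Icc (0 : ℝ) 1, |dk i l t s| := by
        intro t ht
        rw [intervalIntegral_zero_one]
        refine setIntegral_congr_fun measurableSet_Icc fun s hs => ?_
        split_ifs with h0
        · rw [h0, abs_of_nonneg (hk_nonneg i t ht s hs)]
        · rfl
      refine mul_le_mul_of_nonneg_left ?_
        ((abs_nonneg _).trans (hNle i y hy hyR.le ⟨0, left_mem_Icc.2 zero_le_one⟩))
      refine le_csSup ⟨∫ s in Icc (0 : ℝ) 1, Φ i l s, ?_⟩ ⟨t, t.2, hK t t.2⟩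
      rintro _ ⟨τ, hτ, rfl⟩
      exact (hK τ hτ).trans_le ((hker i l hl).integral_abs_le hτ)
    · refine (Finset.abs_sum_le_sum_abs _ _).trans (Finset.sum_le_sum fun j _ => ?_)
      have h1 : |Γ i j l t| ≤ supIcc (iteratedDerivWithin l (γ i j) (Icc 0 1)) := by
        refine le_ciSup (f := fun t : Icc (0 : ℝ) 1 => |Γ i j l t|) ⟨‖Γ i j l‖, ?_⟩ t
        rintro _ ⟨τ, rfl⟩
        exact (Γ i j l).norm_coe_le_norm τ
      have h2 : h i j y.toFun ≤
          sSup (h i j '' {u : Fin n → ℝ → ℝ | memP m u ∧ normP m u = R}) := by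
        refine le_csSup ⟨C i j, ?_⟩
          ⟨_, ⟨memP_toFun hy, (normP_toFun hn hy).trans hyR⟩, rfl⟩
        rintro _ ⟨u, ⟨hu, huR⟩, rfl⟩
        exact hC i j u hu huR.le
      rw [abs_mul, abs_of_nonneg (hcnonneg i j y hy), mul_right_comm]
      have h3 := hh_nonneg i j _ (memP_toFun hy)
      have h4 := hη i j
      have h5 := (abs_nonneg _).trans h1
      gcongr
  obtain ⟨w, hw, hw0, hwL⟩ := exists_nonneg_mul_le_of_spectralRadius (hGcpt i₀ 0) (hGmono i₀)
    (hrL_pos i₀) (hLG ▸ hrL i₀)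
  set φ : JetSpace m := fun i l => G i l (if i = i₀ then w else 0) with hφ
  have hφJ : φ ∈ jetCone m := by
    refine fun i => ⟨hGjet i _, hGnonneg i _ fun t => ?_⟩
    split_ifs
    · exact hw0 t
    · exact le_rfl
  have hTr : ∀ y ∈ jetCone m, ‖y‖ < r → ∀ σ : ℝ, 0 < σ → y ≠ T y + σ • φ := by
    intro y hy hyr σ hσ hfix
    have haδ : 1 ≤ lam i₀ * δ * rL i₀ := by
      have := hrL_pos i₀
      rwa [div_le_iff₀ hδ, inv_le_iff_one_le_mul₀ this] at hidx0a
    refine not_mul_apply_add_le_of_monotone (hGmono i₀) (hrL_pos i₀) hw hw0 hwL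
      (y := y i₀ 0) (N := nemytskii (hf_cont i₀) y) hδ.le (hlam i₀) haδ hσ (hy i₀).2
      (fun t => ?_) fun t => ?_
    · rw [nemytskii_apply _ hy]
      exact hidx0b t t.2 _ (apply_mem_Jset hy hyr.le t)
    · have h1 : y i₀ 0 t = T y i₀ 0 t + σ * G i₀ 0 w t := by
        conv_lhs => rw [hfix]
        simp [hφ]
      rw [h1, hT, hammersteinMap_apply_apply]
      have h2 := hcΓ i₀ y hy t
      have h3 : G i₀ 0 (N i₀ y) t = lam i₀ * G i₀ 0 (nemytskii (hf_cont i₀) y) t := by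
        simp [hN]
      linarith
  obtain ⟨y, hy, hyT, hry, hyR⟩ := exists_fixedPoint_mem_annulus convex_jetCone isClosed_jetCone
    zero_mem_jetCone (fun _ hx _ hy => add_mem_jetCone hx hy)
    (fun _ hc _ hx => smul_mem_jetCone hc hx) (hr.trans hrR) hrR hTc hTJ hQ
    (fun y hy hyR => hTQ ⟨hy, hyR⟩) hTR hφJ hTr
  refine ⟨y.toFun, memP_toFun hy, fun i t ht => ?_, (normP_toFun hn hy).symm ▸ hry,
    (normP_toFun hn hy).symm ▸ hyR⟩
  have h1 : y.toFun i t = T y i 0 ⟨t, ht⟩ := by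
    rw [hyT]
    exact extendIcc_of_mem _ ht
  rw [h1, hT, hammersteinMap_apply_apply]
  congr 1
  · simp only [hN, map_smul, ContinuousMap.smul_apply, smul_eq_mul]
    congr 1
    refine intervalIntegral.integral_congr fun s hs => ?_
    rw [uIcc_of_le zero_le_one] at hs
    simp only
    rw [extendIcc_of_mem _ hs, nemytskii_apply _ hy, jet_toFun hy hs]
    simp only [extendIcc_of_mem _ hs]
    rfl
  · refine Finset.sum_congr rfl fun j _ => ?_
    rw [hΓ0]
    simp only [hc]
    ring
end

section
/- Consider the boundary value problem u₁''(t) + λ₁·u₁(t)·(2 − t·sin(u₂(t)u₁'(t))) = 0 and u₂''''(t) = λ₂·u₂(t)·(2 − t·cos(u₁(t)u₂'''(t))) on (0,1), with boundary conditions u₁(0) = 0, u₁(1) = η₁₁·u₁(1/4)·cos²(u₁'(3/4)·u₂''(1/4)), u₂(0) = η₂₁·u₂(3/4)·sin²(u₁'(1/4)·u₂'''(3/4)), u₂''(0) = u₂(1) = u₂''(1) = 0, where λ₁, λ₂, η₁₁, η₂₁ ≥ 0. If max{ (3/8)λ₁ + η₁₁, (5/128)λ₂ + η₂₁ } < 1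 (for instance λ₁ = 1, λ₂ = 5, η₁₁ = 1/2, η₂₁ = 1/3), then the only solution (u₁,u₂) with u₁ ∈ C²[0,1], u₂ ∈ C⁴[0,1] and u₁, u₂ ≥ 0 on [0,1] is the zero solution u₁ ≡ 0, u₂ ≡ 0. -/
open Set MeasureTheory Real

/-- `j`-th derivative on `[0,1]`. -/
noncomputable def D (j : ℕ) (g : ℝ → ℝ) : ℝ → ℝ :=
  iteratedDerivWithin j g (Set.Icc 0 1)

/-- The `j`-th derivative on `[0,1]` has the `(j+1)`-st as derivative at interior points. -/
lemma hasDerivAt_D {g : ℝ → ℝ} {n j : ℕ} (hg : ContDiffOn ℝ n g (Set.Icc 0 1)) (hj : j < n)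
    {t : ℝ} (ht : t ∈ Set.Ioo (0:ℝ) 1) : HasDerivAt (D j g) (D (j + 1) g t) t := by
  have hd := (hg.differentiableOn_iteratedDerivWithin (m := j) (by exact_mod_cast hj)
    (uniqueDiffOn_Icc zero_lt_one)) t (Set.Ioo_subset_Icc_self ht)
  have h := hd.hasDerivWithinAt.hasDerivAt (Icc_mem_nhds ht.1 ht.2)
  rw [← iteratedDerivWithin_succ] at h
  exact h

lemma continuousOn_D {g : ℝ → ℝ} {n j : ℕ} (hg : ContDiffOn ℝ n g (Set.Icc 0 1)) (hj : j ≤ n) :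
    ContinuousOn (D j g) (Set.Icc 0 1) :=
  hg.continuousOn_iteratedDerivWithin (by exact_mod_cast hj) (uniqueDiffOn_Icc zero_lt_one)

lemma D_zero (g : ℝ → ℝ) : D 0 g = g := iteratedDerivWithin_zero

/-- A function on `[0,1]` with nonnegative second derivative which is nonpositive at both
endpoints is nonpositive. -/
lemma nonpos_of_hasDerivAt2_nonneg {f f' f'' : ℝ → ℝ} (hc : ContinuousOn f (Set.Icc 0 1))
    (hf' : ∀ t ∈ Set.Ioo (0:ℝ) 1, HasDerivAt f (f' t) t)
    (hf'' : ∀ t ∈ Set.Ioo (0:ℝ) 1, HasDerivAt f' (f'' t) t)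
    (hnn : ∀ t ∈ Set.Ioo (0:ℝ) 1, 0 ≤ f'' t) (h0 : f 0 ≤ 0) (h1 : f 1 ≤ 0) :
    ∀ t ∈ Set.Icc (0:ℝ) 1, f t ≤ 0 := by
  intro t ht
  have hconv : ConvexOn ℝ (Set.Icc (0:ℝ) 1) f := by
    refine convexOn_of_hasDerivWithinAt2_nonneg (f' := f') (f'' := f'') (convex_Icc 0 1) hc ?_ ?_ ?_
      <;> rw [interior_Icc]
    · exact fun x hx => (hf' x hx).hasDerivWithinAt
    · exact fun x hx => (hf'' x hx).hasDerivWithinAt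
    · exact hnn
  exact (hconv.le_max_of_mem_Icc (by simp) (by simp) ht).trans (max_le h0 h1)

/-- If every upper bound `M` of a nonnegative continuous function on `[0,1]` improves to `c * M`
with a fixed `c < 1`, the function vanishes. -/
lemma eq_zero_of_contraction {f : ℝ → ℝ} {c : ℝ} (hc : c < 1) (hf : ContinuousOn f (Set.Icc 0 1))
    (hnn : ∀ t ∈ Set.Icc (0:ℝ) 1, 0 ≤ f t)
    (h : ∀ M, 0 ≤ M → (∀ t ∈ Set.Icc (0:ℝ) 1, f t ≤ M) → ∀ t ∈ Set.Icc (0:ℝ) 1, f t ≤ c * M) :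
    ∀ t ∈ Set.Icc (0:ℝ) 1, f t = 0 := by
  obtain ⟨s, hs, hmax⟩ := isCompact_Icc.exists_isMaxOn (Set.nonempty_Icc.2 zero_le_one) hf
  have hM : ∀ t ∈ Set.Icc (0:ℝ) 1, f t ≤ f s := fun t ht => hmax ht
  have h2 := h (f s) (hnn s hs) hM s hs
  have h3 : f s ≤ 0 := by nlinarith [hnn s hs]
  exact fun t ht => le_antisymm ((hM t ht).trans h3) (hnn t ht)

/-- if `max{ (3/8)λ₁ + η₁₁, (5/128)λ₂ + η₂₁ } < 1`, then the only
nonnegative solution `(u₁,u₂) ∈ C²[0,1] × C⁴[0,1]` of the boundary value problem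
`u₁'' + λ₁ u₁ (2 − t sin(u₂ u₁')) = 0`,
`u₂'''' = λ₂ u₂ (2 − t cos(u₁ u₂'''))` on `(0,1)`,
`u₁(0) = 0`, `u₁(1) = η₁₁ u₁(1/4) cos²(u₁'(3/4) u₂''(1/4))`,
`u₂(0) = η₂₁ u₂(3/4) sin²(u₁'(1/4) u₂'''(3/4))`, `u₂''(0) = u₂(1) = u₂''(1) = 0`
is the trivial one. -/
theorem stmt_18 (lam₁ lam₂ η₁₁ η₂₁ : ℝ)
    (hlam₁ : 0 ≤ lam₁) (hlam₂ : 0 ≤ lam₂) (hη₁₁ : 0 ≤ η₁₁) (hη₂₁ : 0 ≤ η₂₁)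
    (hmax : max ((3 / 8) * lam₁ + η₁₁) ((5 / 128) * lam₂ + η₂₁) < 1)
    (u₁ u₂ : ℝ → ℝ)
    (hu₁ : ContDiffOn ℝ 2 u₁ (Set.Icc 0 1)) (hu₂ : ContDiffOn ℝ 4 u₂ (Set.Icc 0 1))
    (hnn : ∀ t ∈ Set.Icc (0:ℝ) 1, 0 ≤ u₁ t ∧ 0 ≤ u₂ t)
    (hode₁ : ∀ t ∈ Set.Ioo (0:ℝ) 1,
      D 2 u₁ t + lam₁ * (u₁ t * (2 - t * Real.sin (u₂ t * D 1 u₁ t))) = 0)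
    (hode₂ : ∀ t ∈ Set.Ioo (0:ℝ) 1,
      D 4 u₂ t = lam₂ * (u₂ t * (2 - t * Real.cos (u₁ t * D 3 u₂ t))))
    (hbc₁ : u₁ 0 = 0)
    (hbc₂ : u₁ 1 = η₁₁ * (u₁ (1 / 4) * (Real.cos (D 1 u₁ (3 / 4) * D 2 u₂ (1 / 4))) ^ 2))
    (hbc₃ : u₂ 0 = η₂₁ * (u₂ (3 / 4) * (Real.sin (D 1 u₁ (1 / 4) * D 3 u₂ (3 / 4))) ^ 2))
    (hbc₄ : D 2 u₂ 0 = 0) (hbc₅ : u₂ 1 = 0) (hbc₆ : D 2 u₂ 1 = 0) :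
    ∀ t ∈ Set.Icc (0:ℝ) 1, u₁ t = 0 ∧ u₂ t = 0 := by
  obtain ⟨hm₁, hm₂⟩ := max_lt_iff.1 hmax
  have hquarter : (1 / 4 : ℝ) ∈ Set.Icc (0:ℝ) 1 := by norm_num
  have hthree : (3 / 4 : ℝ) ∈ Set.Icc (0:ℝ) 1 := by norm_num
  have hz₁ : ∀ t ∈ Set.Icc (0:ℝ) 1, u₁ t = 0 := by
    refine eq_zero_of_contraction hm₁ hu₁.continuousOn (fun t ht => (hnn t ht).1) ?_
    intro M hM0 hM t ht
    have hb : u₁ 1 ≤ η₁₁ * M := by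
      rw [hbc₂]
      refine mul_le_mul_of_nonneg_left ?_ hη₁₁
      exact (mul_le_of_le_one_right (hnn _ hquarter).1 (Real.cos_sq_le_one _)).trans
        (hM _ hquarter)
    have key := nonpos_of_hasDerivAt2_nonneg
      (f := fun s => u₁ s - (η₁₁ * M * s + 3 * lam₁ * M / 2 * (s - s ^ 2)))
      (f' := fun s => D 1 u₁ s - (η₁₁ * M + 3 * lam₁ * M / 2 * (1 - 2 * s)))
      (f'' := fun s => D 2 u₁ s + 3 * lam₁ * M)
      (hu₁.continuousOn.sub (by fun_prop)) ?_ ?_ ?_ (by simp [hbc₁]) (by simpa using hb) t ht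
    · have hs : t - t ^ 2 ≤ 1 / 4 := by nlinarith [sq_nonneg (t - 1 / 2)]
      have e1 := mul_le_mul_of_nonneg_left hs (by positivity : 0 ≤ 3 * lam₁ * M / 2)
      have e2 := mul_le_mul_of_nonneg_left ht.2 (by positivity : 0 ≤ η₁₁ * M)
      linarith
    · intro s hs
      have h := hasDerivAt_D (j := 0) hu₁ (by norm_num) hs
      rw [D_zero] at h
      refine (h.sub (((hasDerivAt_id s).const_mul (η₁₁ * M)).add
        (((hasDerivAt_id s).sub ((hasDerivAt_id s).pow 2)).const_mul
          (3 * lam₁ * M / 2)))).congr_deriv ?_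
      simp
    · intro s hs
      have h := hasDerivAt_D (j := 1) hu₁ (by norm_num) hs
      refine (h.sub ((((hasDerivAt_id s).const_mul 2).const_sub 1).const_mul
          (3 * lam₁ * M / 2) |>.const_add (η₁₁ * M))).congr_deriv ?_
      ring
    · intro s hs
      have hs' := Set.Ioo_subset_Icc_self hs
      have h := hode₁ s hs
      have hsin : 2 - s * Real.sin (u₂ s * D 1 u₁ s) ≤ 3 := by
        nlinarith [Real.neg_one_le_sin (u₂ s * D 1 u₁ s), hs.1, hs.2]
      have e1 : u₁ s * (2 - s * Real.sin (u₂ s * D 1 u₁ s)) ≤ M * 3 :=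
        (mul_le_mul_of_nonneg_left hsin (hnn s hs').1).trans
          (mul_le_mul_of_nonneg_right (hM s hs') (by norm_num))
      have e2 := mul_le_mul_of_nonneg_left e1 hlam₁
      linarith
  have hz₂ : ∀ t ∈ Set.Icc (0:ℝ) 1, u₂ t = 0 := by
    refine eq_zero_of_contraction hm₂ hu₂.continuousOn (fun t ht => (hnn t ht).2) ?_
    intro M hM0 hM t ht
    have hb : u₂ 0 ≤ η₂₁ * M := by
      rw [hbc₃]
      refine mul_le_mul_of_nonneg_left ?_ hη₂₁
      exact (mul_le_of_le_one_right (hnn _ hthree).2 (Real.sin_sq_le_one _)).trans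
        (hM _ hthree)
    have hw := nonpos_of_hasDerivAt2_nonneg
      (f := fun s => 3 * lam₂ * M / 2 * (s ^ 2 - s) - D 2 u₂ s)
      (f' := fun s => 3 * lam₂ * M / 2 * (2 * s - 1) - D 3 u₂ s)
      (f'' := fun s => 3 * lam₂ * M - D 4 u₂ s)
      (ContinuousOn.sub (by fun_prop) (continuousOn_D hu₂ (by norm_num))) ?_ ?_ ?_
      (by simp [hbc₄]) (by simp [hbc₆])
    · have key := nonpos_of_hasDerivAt2_nonneg
        (f := fun s => u₂ s - (η₂₁ * M * (1 - s) + lam₂ * M / 8 * (s ^ 4 - 2 * s ^ 3 + s)))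
        (f' := fun s => D 1 u₂ s - (-(η₂₁ * M) + lam₂ * M / 8 * (4 * s ^ 3 - 6 * s ^ 2 + 1)))
        (f'' := fun s => D 2 u₂ s - 3 * lam₂ * M / 2 * (s ^ 2 - s))
        (hu₂.continuousOn.sub (by fun_prop)) ?_ ?_ ?_ (by simpa using hb)
        (by norm_num [hbc₅]) t ht
      · have hs : t ^ 4 - 2 * t ^ 3 + t ≤ 5 / 16 := by
          have h1 : t - t ^ 2 ≤ 1 / 4 := by nlinarith [sq_nonneg (t - 1 / 2)]
          have h2 : 0 ≤ t - t ^ 2 := by nlinarith [ht.1, ht.2]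
          nlinarith
        have e1 := mul_le_mul_of_nonneg_left hs (by positivity : 0 ≤ lam₂ * M / 8)
        have e2 := mul_nonneg (by positivity : 0 ≤ η₂₁ * M) ht.1
        linarith
      · intro s hs
        have h := hasDerivAt_D (j := 0) hu₂ (by norm_num) hs
        rw [D_zero] at h
        refine (h.sub ((((hasDerivAt_id s).const_sub 1).const_mul (η₂₁ * M)).add
          (((((hasDerivAt_id s).pow 4).sub (((hasDerivAt_id s).pow 3).const_mul 2)).add
            (hasDerivAt_id s)).const_mul (lam₂ * M / 8)))).congr_deriv ?_
        simp only [id, Nat.cast_ofNat]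
        ring
      · intro s hs
        have h := hasDerivAt_D (j := 1) hu₂ (by norm_num) hs
        refine (h.sub ((((((hasDerivAt_id s).pow 3).const_mul 4).sub
          (((hasDerivAt_id s).pow 2).const_mul 6)).add_const 1).const_mul
            (lam₂ * M / 8) |>.const_add (-(η₂₁ * M)))).congr_deriv ?_
        simp
        ring
      · intro s hs
        have h := hw s (Set.Ioo_subset_Icc_self hs)
        linarith
    · intro s hs
      have h := hasDerivAt_D (j := 2) hu₂ (by norm_num) hs
      refine (((((hasDerivAt_id s).pow 2).sub (hasDerivAt_id s)).const_mul
        (3 * lam₂ * M / 2)).sub h).congr_deriv ?_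
      simp
    · intro s hs
      have h := hasDerivAt_D (j := 3) hu₂ (by norm_num) hs
      refine (((((hasDerivAt_id s).const_mul 2).sub_const 1).const_mul
        (3 * lam₂ * M / 2)).sub h).congr_deriv ?_
      ring
    · intro s hs
      have hs' := Set.Ioo_subset_Icc_self hs
      have h := hode₂ s hs
      have hcos : 2 - s * Real.cos (u₁ s * D 3 u₂ s) ≤ 3 := by
        nlinarith [Real.neg_one_le_cos (u₁ s * D 3 u₂ s), hs.1, hs.2]
      have e1 : u₂ s * (2 - s * Real.cos (u₁ s * D 3 u₂ s)) ≤ M * 3 :=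
        (mul_le_mul_of_nonneg_left hcos (hnn s hs').2).trans
          (mul_le_mul_of_nonneg_right (hM s hs') (by norm_num))
      have e2 := mul_le_mul_of_nonneg_left e1 hlam₂
      linarith
  exact fun t ht => ⟨hz₁ t ht, hz₂ t ht⟩
end
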